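/- arXiv:1702.07026 — 3 statements merged into one kernel-verified Lean document; each statement's English description precedes it below -/
import Mathlib

section
/- For every $n \in \mathbb{N}$ and every $\varepsilon > 0$, $\mathbb{E}_{\mathbf{B}}[Y_\varepsilon^n] = \int_{\mathbb{R}^{2n}} \big( (Q_\varepsilon \star h_n)(x_1, \dots, x_n) \big)^2\, d\mathbf{x} \le \int_{\mathbb{R}^{2n}} h_n(x_1, \dots, x_n)^2\, d\mathbf{x}$, where $Q_\varepsilon(z_1,\dots,z_n) = \prod_{k=1}^n \rho_\varepsilon(z_k)$ and $h_n(z_1, \dots, z_n) = \sum_{\sigma \in S_n} \int_{0 \le s_1 < \dots < s_n \le 1} \prod_{k=1}^n p_{s_k - s_{k-1}}(z_{\sigma(k)} - z_{\sigma(k-1)})\, d\mathbf{s}$ (with $s_0 = 0$ and $z_{\sigma(0)} = 0$). -/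
open MeasureTheory ProbabilityTheory Real Filter Set
open scoped ENNReal NNReal

/-- The standard Gaussian-type measure on `ι → ℝ` with covariance `v · Id`:
the product over coordinates of the real Gaussian `N(0, v)`. -/
noncomputable def gaussianPi (ι : Type*) [Fintype ι] (v : NNReal) : Measure (ι → ℝ) :=
  Measure.pi fun _ => gaussianReal 0 v

/-- A standard Brownian motion with values in `ι → ℝ` (time parameter in `[0,∞)`,
the process being given on all of `ℝ` with the defining properties imposed at
nonnegative times): it starts at the origin, has continuous paths, independent
increments, and Gaussian increments `B_t - B_s ~ N(0, (t-s)·Id)` for `0 ≤ s ≤ t`. -/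
structure IsStdBM {Ω : Type*} [MeasurableSpace Ω] (P : Measure Ω)
    {ι : Type*} [Fintype ι] (B : ℝ → Ω → ι → ℝ) : Prop where
  isProb : IsProbabilityMeasure P
  init : ∀ ω, B 0 ω = 0
  cont : ∀ ω i, Continuous fun t => B t ω i
  meas : ∀ t, Measurable (B t)
  indep_incr : ∀ (n : ℕ) (t : Fin (n + 1) → ℝ), (∀ i, 0 ≤ t i) → Monotone t →
    iIndepFun
      (fun k : Fin n => fun ω => B (t k.succ) ω - B (t k.castSucc) ω) P
  gauss_incr : ∀ s t : ℝ, 0 ≤ s → s ≤ t →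
    P.map (fun ω => B t ω - B s ω) = gaussianPi ι (t - s).toNNReal

/-- The `k`-th planar component of a Brownian motion indexed by `κ × Fin 2`;
a standard BM in `(κ × Fin 2) → ℝ` is precisely a family of independent standard
planar Brownian motions indexed by `κ`. -/
def planarComp {Ω κ : Type*} (W : ℝ → Ω → κ × Fin 2 → ℝ) (k : κ) :
    ℝ → Ω → Fin 2 → ℝ :=
  fun t ω i => W t ω (k, i)

/-- The rescaling `R_ε(x) = ε⁻² R(x/ε)` of a function `R : ℝ² → ℝ`. -/
noncomputable def mollify (R : (Fin 2 → ℝ) → ℝ) (ε : ℝ) (x : Fin 2 → ℝ) : ℝ :=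
  (ε ^ 2)⁻¹ * R (ε⁻¹ • x)

/-- `β_ε(A) = ∫_A R_ε(B_s - B_u) du ds` for a single process `B`,
where the integration variable is `p = (u, s) ∈ A ⊆ ℝ₊²`. -/
noncomputable def betaSet (R : (Fin 2 → ℝ) → ℝ) (ε : ℝ) {Ω : Type*}
    (B : ℝ → Ω → Fin 2 → ℝ) (A : Set (ℝ × ℝ)) (ω : Ω) : ℝ :=
  ∫ p in A, mollify R ε (B p.2 ω - B p.1 ω)

/-- `α_ε(A) = ∫_A R_ε(B¹_s - B²_u) du ds` for two processes `B¹, B²`,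
where the integration variable is `p = (u, s) ∈ A ⊆ ℝ₊²`. -/
noncomputable def alphaSet (R : (Fin 2 → ℝ) → ℝ) (ε : ℝ) {Ω : Type*}
    (B₁ B₂ : ℝ → Ω → Fin 2 → ℝ) (A : Set (ℝ × ℝ)) (ω : Ω) : ℝ :=
  ∫ p in A, mollify R ε (B₁ p.2 ω - B₂ p.1 ω)

/-- The triangle `[0,t]²_< = {(u,s) : 0 ≤ u < s ≤ t}`. -/
def ltSet (t : ℝ) : Set (ℝ × ℝ) := {p : ℝ × ℝ | 0 ≤ p.1 ∧ p.1 < p.2 ∧ p.2 ≤ t}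

/-- The planar heat kernel `p_v(x) = (2πv)⁻¹ exp(-|x|²/(2v))`. -/
noncomputable def heatKernel (v : ℝ) (x : Fin 2 → ℝ) : ℝ :=
  (2 * π * v)⁻¹ * Real.exp (-(x 0 ^ 2 + x 1 ^ 2) / (2 * v))

/-- The simplex `{0 ≤ s₁ < s₂ < ⋯ < sₙ ≤ 1}` in `(Fin n → ℝ)`. -/
def simplex01 (n : ℕ) : Set (Fin n → ℝ) :=
  {s | (∀ k, s k ∈ Set.Icc (0:ℝ) 1) ∧ StrictMono s}

/-- `h_n(z₁,…,zₙ) = ∑_{σ ∈ Sₙ} ∫_{0 ≤ s₁ < ⋯ < sₙ ≤ 1}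
∏_{k=1}^n p_{s_k - s_{k-1}}(z_{σ(k)} - z_{σ(k-1)}) ds`, with the conventions
`s₀ = 0` and `z_{σ(0)} = 0`. -/
noncomputable def hfun (n : ℕ) (z : Fin n → Fin 2 → ℝ) : ℝ≥0∞ :=
  ∑ σ : Equiv.Perm (Fin n),
    ∫⁻ s in simplex01 n,
      ENNReal.ofReal (∏ k : Fin n,
        heatKernel
          (s k - if (k : ℕ) = 0 then 0
            else s ⟨(k : ℕ) - 1, Nat.lt_of_le_of_lt (Nat.sub_le _ _) k.isLt⟩)
          (z (σ k) - if (k : ℕ) = 0 then 0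
            else z (σ ⟨(k : ℕ) - 1, Nat.lt_of_le_of_lt (Nat.sub_le _ _) k.isLt⟩)))


namespace S10

lemma lintegral_pi_prod {α : Type*} [MeasurableSpace α] : ∀ {n : ℕ} (μ : Fin n → Measure α)
    [∀ i, SigmaFinite (μ i)] (f : Fin n → α → ℝ≥0∞) (_ : ∀ i, Measurable (f i)),
    ∫⁻ x, ∏ i, f i (x i) ∂Measure.pi μ = ∏ i, ∫⁻ a, f i a ∂μ i := by
  intro n
  induction n with
  | zero => intro μ _ f hf; simp
  | succ n ih =>
    intro μ _ f hf
    rw [← ((measurePreserving_piFinSuccAbove μ 0).symm _).lintegral_comp_emb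
      (MeasurableEquiv.measurableEmbedding _)]
    simp only [Fin.prod_univ_succ]
    rw [lintegral_prod]
    · simp only [MeasurableEquiv.piFinSuccAbove_symm_apply, Fin.insertNthEquiv_apply,
        Fin.insertNth_zero, Fin.cons_zero, Fin.cons_succ, Fin.succAbove_zero, cast_eq]
      have := fun a => lintegral_const_mul (μ := Measure.pi fun j : Fin n => μ j.succ)
        (f 0 a) (f := fun x : Fin n → α => ∏ i : Fin n, f i.succ (x i))
        (Finset.measurable_prod _ fun i _ => (hf _).comp (measurable_pi_apply _))
      simp only [this]
      rw [lintegral_mul_const _ (hf 0), ih (fun j => μ j.succ) (fun j => f j.succ) (fun j => hf _)]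
    · refine Measurable.aemeasurable ?_
      refine Measurable.comp (g := fun x : Fin (n+1) → α => f 0 (x 0) * ∏ i : Fin n, f i.succ (x i.succ)) ?_ (MeasurableEquiv.measurable _)
      refine ((hf _).comp (measurable_pi_apply _)).mul ?_
      exact (Finset.measurable_prod _ fun i _ => (hf _).comp (measurable_pi_apply _))

lemma pi_wd {α : Type*} [MeasurableSpace α] {n : ℕ} (μ : Fin n → Measure α)
    [∀ i, SigmaFinite (μ i)] (f : Fin n → α → ℝ≥0∞) (hf : ∀ i, Measurable (f i))
    [∀ i, SigmaFinite ((μ i).withDensity (f i))] :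
    Measure.pi (fun i => (μ i).withDensity (f i))
      = (Measure.pi μ).withDensity (fun x => ∏ i, f i (x i)) := by
  apply Measure.pi_eq
  intro s hs
  rw [withDensity_apply _ (MeasurableSet.univ_pi hs)]
  rw [Measure.restrict_pi_pi, lintegral_pi_prod _ _ hf]
  simp [withDensity_apply _ (hs _)]

lemma heat_nonneg {v : ℝ} (hv : 0 ≤ v) (x) : 0 ≤ heatKernel v x := by
  unfold heatKernel; positivity

lemma measurable_heat : Measurable (fun q : ℝ × (Fin 2 → ℝ) => heatKernel q.1 q.2) := by
  unfold heatKernel; fun_prop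

lemma gauss_density (v : ℝ≥0) (hv : v ≠ 0) : gaussianPi (Fin 2) v
    = (volume : Measure (Fin 2 → ℝ)).withDensity (fun x => ENNReal.ofReal (heatKernel v x)) := by
  unfold gaussianPi
  simp only [gaussianReal_of_var_ne_zero _ hv]
  have : SigmaFinite ((volume : Measure ℝ).withDensity (gaussianPDF 0 v)) := by
    rw [← gaussianReal_of_var_ne_zero _ hv]; infer_instance
  rw [pi_wd (fun _ : Fin 2 => volume) (fun _ => gaussianPDF 0 v) (fun _ => measurable_gaussianPDF _ _)]
  congr 1
  ext x
  simp only [Fin.prod_univ_two, gaussianPDF]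
  rw [← ENNReal.ofReal_mul (gaussianPDFReal_nonneg _ _ _)]
  congr 1
  simp only [gaussianPDFReal, heatKernel, sub_zero]
  have hv' : (0:ℝ) < v := by positivity
  have h2 : (√(2 * π * v))⁻¹ * (√(2 * π * v))⁻¹ = (2 * π * v)⁻¹ := by
    rw [← mul_inv, Real.mul_self_sqrt (by positivity)]
  rw [mul_mul_mul_comm, h2, ← Real.exp_add]
  congr 2
  ring

/-- cumulative sums -/
def cs {α : Type*} [AddCommMonoid α] {n : ℕ} (z : Fin n → α) (k : Fin n) : α :=
  ∑ j : Fin n, if j ≤ k then z j else 0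

/-- previous value -/
def prv {α : Type*} [Zero α] {n : ℕ} (z : Fin n → α) (k : Fin n) : α :=
  if (k : ℕ) = 0 then 0
            else z ⟨(k : ℕ) - 1, Nat.lt_of_le_of_lt (Nat.sub_le _ _) k.isLt⟩

lemma prv_zero {α : Type*} [Zero α] {n : ℕ} (z : Fin (n+1) → α) : prv z 0 = 0 := by simp [prv]
lemma prv_succ {α : Type*} [Zero α] {n : ℕ} (z : Fin (n+1) → α) (k : Fin n) :
    prv z k.succ = z k.castSucc := by simp [prv]; rfl

lemma cons_castSucc {α : Type*} [Zero α] {n : ℕ} (z : Fin n → α) (k : Fin n) :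
    (Fin.cons 0 z : Fin (n+1) → α) k.castSucc = prv z k := by
  cases n with
  | zero => exact k.elim0
  | succ n =>
    refine Fin.cases ?_ (fun i => ?_) k
    · simp [prv_zero]
    · rw [prv_succ, Fin.castSucc_succ, Fin.cons_succ]

lemma cs_zero {α : Type*} [AddCommMonoid α] {n : ℕ} (z : Fin (n+1) → α) : cs z 0 = z 0 := by
  simp [cs]

lemma cs_succ {α : Type*} [AddCommMonoid α] {n : ℕ} (z : Fin (n+1) → α) (k : Fin n) :
    cs z k.succ = z 0 + cs (fun j => z j.succ) k := by
  simp [cs, Fin.sum_univ_succ]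

lemma cs_eq {α : Type*} [AddCommMonoid α] : ∀ {n : ℕ} (z : Fin n → α) (k : Fin n),
    cs z k = prv (cs z) k + z k := by
  intro n
  induction n with
  | zero => intro z k; exact k.elim0
  | succ n ih =>
    intro z k
    refine Fin.cases ?_ (fun i => ?_) k
    · simp [prv_zero, cs_zero]
    · rw [prv_succ, cs_succ, ih]
      cases n with
      | zero => exact i.elim0
      | succ n =>
      refine Fin.cases ?_ (fun j => ?_) i
      · simp [prv_zero, cs_zero]
      · rw [prv_succ, Fin.castSucc_succ, cs_succ]
        exact (add_assoc _ _ _).symm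

lemma cs_sub_prv {α : Type*} [AddCommGroup α] {n : ℕ} (z : Fin n → α) (k : Fin n) :
    cs z k - prv (cs z) k = z k := by rw [cs_eq]; abel

lemma cs_of_sub {α : Type*} [AddCommGroup α] {n : ℕ} (z : Fin n → α) :
    cs (fun k => z k - prv z k) = z := by
  have h : ∀ m (hm : m < n), cs (fun k => z k - prv z k) ⟨m, hm⟩ = z ⟨m, hm⟩ := by
    intro m
    induction m with
    | zero => intro hm; rw [cs_eq]; simp [prv]
    | succ m ih =>
      intro hm
      have e : ∀ y : Fin n → α, prv y ⟨m+1, hm⟩ = y ⟨m, by omega⟩ := fun y => by simp [prv]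
      rw [cs_eq, e, ih]
      simp [e]
  ext k; exact h k k.2

lemma measurable_cs {n : ℕ} : Measurable (cs : (Fin n → Fin 2 → ℝ) → (Fin n → Fin 2 → ℝ)) := by
  unfold cs
  refine measurable_pi_lambda _ fun k => Finset.measurable_sum _ fun j _ => ?_
  split_ifs <;> fun_prop

lemma mp_cs : ∀ {n : ℕ}, MeasurePreserving (cs : (Fin n → Fin 2 → ℝ) → (Fin n → Fin 2 → ℝ))
    volume volume := by
  intro n
  induction n with
  | zero =>
    have : (cs : (Fin 0 → Fin 2 → ℝ) → (Fin 0 → Fin 2 → ℝ)) = id := by ext z k; exact k.elim0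
    rw [this]; exact MeasurePreserving.id _
  | succ n ih =>
    have e := volume_preserving_piFinSuccAbove (fun _ : Fin (n+1) => Fin 2 → ℝ) 0
    have hg : MeasurePreserving (fun p : (Fin 2 → ℝ) × (Fin n → Fin 2 → ℝ) =>
        (p.1, (fun a b => (fun _ => a) + cs b) p.1 p.2)) volume volume := by
      refine MeasurePreserving.skew_product (g := fun (a : Fin 2 → ℝ) (b : Fin n → Fin 2 → ℝ) => (fun _ => a) + cs b)
        (MeasurePreserving.id (volume : Measure (Fin 2 → ℝ))) ?_ ?_
      · refine measurable_pi_lambda _ fun k => ?_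
        exact measurable_fst.add ((measurable_pi_apply k).comp (measurable_cs.comp measurable_snd))
      · refine ae_of_all _ fun a => ?_
        exact ((measurePreserving_add_left volume (fun _ : Fin n => a)).comp ih).map_eq
    have h := ((e.symm _).comp hg).comp e
    refine (congrArg (fun F => MeasurePreserving F volume volume) ?_).mpr h
    funext z
    funext k
    refine Fin.cases ?_ (fun i => ?_) k
    · simp [cs_zero]
    · simp [cs_succ]; rfl

end S10

namespace S10

instance {ι : Type*} [Fintype ι] (v : ℝ≥0) : IsProbabilityMeasure (gaussianPi ι v) := by
  unfold gaussianPi; infer_instance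

lemma gaussianPi_map_precomp {ι κ : Type*} [Fintype ι] [Fintype κ] (v : ℝ≥0) (g : κ → ι)
    (hg : Function.Injective g) :
    (gaussianPi ι v).map (fun x k => x (g k)) = gaussianPi κ v := by
  have h1 : iIndepFun (fun (i : ι) (x : ι → ℝ) => x i) (gaussianPi ι v) :=
    iIndepFun_pi (μ := fun _ : ι => gaussianReal 0 v) (X := fun _ x => x) (fun _ => aemeasurable_id)
  have h2 := h1.precomp hg
  have h3 := (iIndepFun_iff_map_fun_eq_pi_map (μ := gaussianPi ι v)
    (f := fun (k : κ) (x : ι → ℝ) => x (g k)) (fun i => (measurable_pi_apply _).aemeasurable)).1 h2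
  rw [h3]
  conv_rhs => unfold gaussianPi
  congr 1
  ext1 k
  exact (measurePreserving_eval (fun _ : ι => gaussianReal 0 v) (g k)).map_eq

variable {Ω : Type*} [MeasurableSpace Ω] {P : Measure Ω}

lemma planar {W : ℝ → Ω → (Fin 2 × Fin 2) → ℝ} (hW : IsStdBM P W) (c : Fin 2) :
    IsStdBM P (planarComp W c) where
  isProb := hW.isProb
  init := fun ω => by ext i; simp [planarComp, hW.init]
  cont := fun ω i => hW.cont ω (c, i)
  meas := fun t => measurable_pi_lambda _ fun i => (measurable_pi_apply (c, i)).comp (hW.meas t)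
  indep_incr := by
    intro n t h0 ht
    exact (hW.indep_incr n t h0 ht).comp (fun _ x i => x (c, i))
      (fun _ => measurable_pi_lambda _ fun i => measurable_pi_apply _)
  gauss_incr := by
    intro s t hs hst
    rw [← gaussianPi_map_precomp _ (fun i : Fin 2 => ((c, i) : Fin 2 × Fin 2))
      (fun i j h => by simpa using h), ← hW.gauss_incr s t hs hst, Measure.map_map]
    · rfl
    · exact measurable_pi_lambda _ fun i => measurable_pi_apply _
    · exact (hW.meas t).sub (hW.meas s)

lemma cs_incr {ι : Type*} {n : ℕ} [Fintype ι] {B : ℝ → Ω → ι → ℝ} (hB : IsStdBM P B) (s : Fin n → ℝ) (ω : Ω) :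
    cs (fun k => B ((Fin.cons 0 s : Fin (n+1) → ℝ) k.succ) ω
      - B ((Fin.cons 0 s : Fin (n+1) → ℝ) k.castSucc) ω) = fun k => B (s k) ω := by
  have h : ∀ k : Fin n, B ((Fin.cons 0 s : Fin (n+1) → ℝ) k.castSucc) ω = prv (fun k => B (s k) ω) k := by
    intro k
    rw [cons_castSucc]
    unfold prv
    split_ifs
    · exact hB.init ω
    · rfl
  simp only [h, Fin.cons_succ]
  exact cs_of_sub _

lemma cons_mono {n : ℕ} {s : Fin n → ℝ} (h0 : ∀ k, 0 ≤ s k) (hs : Monotone s) :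
    (∀ i, 0 ≤ (Fin.cons 0 s : Fin (n+1) → ℝ) i) ∧ Monotone (Fin.cons 0 s : Fin (n+1) → ℝ) := by
  refine ⟨fun i => ?_, ?_⟩
  · refine Fin.cases ?_ (fun j => ?_) i <;> simp [h0]
  · intro i j
    refine Fin.cases ?_ (fun i => ?_) i
    · intro _
      refine Fin.cases ?_ (fun j => ?_) j <;> simp [h0]
    · refine Fin.cases ?_ (fun j => ?_) j
      · intro h; exact absurd h (by simp)
      · intro h; simpa using hs (Fin.succ_le_succ_iff.1 h)

lemma prv_lt {n : ℕ} {s : Fin n → ℝ} (h0 : ∀ k, 0 < s k) (hs : StrictMono s) (k : Fin n) :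
    0 < s k - prv s k := by
  unfold prv
  split_ifs with h
  · simpa using h0 k
  · rw [sub_pos]; apply hs; rw [Fin.lt_def]; simp; omega

lemma law {n : ℕ} {B : ℝ → Ω → Fin 2 → ℝ} (hB : IsStdBM P B) (s : Fin n → ℝ)
    (h0 : ∀ k, 0 < s k) (hs : StrictMono s) (G : (Fin n → Fin 2 → ℝ) → ℝ≥0∞) (hG : Measurable G) :
    ∫⁻ ω, G (fun k => B (s k) ω) ∂P
      = ∫⁻ z, G z * ENNReal.ofReal (∏ k, heatKernel (s k - prv s k) (z k - prv z k)) := by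
  have := hB.isProb
  obtain ⟨ht0, htm⟩ := cons_mono (fun k => (h0 k).le) hs.monotone
  set t : Fin (n+1) → ℝ := Fin.cons 0 s with ht
  have hi := hB.indep_incr n t ht0 htm
  have hm : ∀ k : Fin n, Measurable (fun ω => B (t k.succ) ω - B (t k.castSucc) ω) :=
    fun k => (hB.meas _).sub (hB.meas _)
  rw [iIndepFun_iff_map_fun_eq_pi_map (fun k => (hm k).aemeasurable)] at hi
  have hk : ∀ k : Fin n, P.map (fun ω => B (t k.succ) ω - B (t k.castSucc) ω)
      = (volume : Measure (Fin 2 → ℝ)).withDensity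
        (fun x => ENNReal.ofReal (heatKernel (s k - prv s k) x)) := by
    intro k
    have hp := prv_lt h0 hs k
    rw [hB.gauss_incr _ _ (ht0 _) (htm (Fin.castSucc_le_succ k))]
    rw [ht, cons_castSucc, Fin.cons_succ, gauss_density, Real.coe_toNNReal _ hp.le]
    simpa using hp
  have hsf : ∀ k : Fin n, SigmaFinite ((volume : Measure (Fin 2 → ℝ)).withDensity
        (fun x => ENNReal.ofReal (heatKernel (s k - prv s k) x))) := by
    intro k
    rw [← hk k]
    have := Measure.isProbabilityMeasure_map (μ := P) (hm k).aemeasurable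
    infer_instance
  have hmh : ∀ k : Fin n, Measurable (fun x => ENNReal.ofReal (heatKernel (s k - prv s k) x)) := by
    intro k
    exact (measurable_heat.comp (measurable_const.prodMk measurable_id)).ennreal_ofReal
  simp only [hk] at hi
  rw [pi_wd _ _ hmh] at hi
  have e1 : ∀ ω, G (fun k => B (s k) ω)
      = (fun d => G (cs d)) (fun k : Fin n => B (t k.succ) ω - B (t k.castSucc) ω) := by
    intro ω
    simp only
    rw [cs_incr hB]
  simp only [e1]
  rw [← lintegral_map (f := fun d => G (cs d)) (hG.comp measurable_cs) (measurable_pi_lambda _ hm), hi,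
    lintegral_withDensity_eq_lintegral_mul _ _ (g := fun d => G (cs d)) (hG.comp measurable_cs)]
  · have hm2 : Measurable (fun z : Fin n → Fin 2 → ℝ =>
        G z * ENNReal.ofReal (∏ k, heatKernel (s k - prv s k) (z k - prv z k))) := by
      refine hG.mul (Measurable.ennreal_ofReal (Finset.measurable_prod _ fun k _ => ?_))
      refine measurable_heat.comp (measurable_const.prodMk ?_)
      refine (measurable_pi_apply _).sub ?_
      unfold prv
      split_ifs <;> fun_prop
    rw [← mp_cs.lintegral_comp hm2]
    refine lintegral_congr fun d => ?_
    simp only [cs_sub_prv, Pi.mul_apply]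
    rw [mul_comm, ENNReal.ofReal_prod_of_nonneg]
    intro k _
    exact heat_nonneg (prv_lt h0 hs k).le _
  · exact Finset.measurable_prod _ fun k _ => (hmh k).comp (measurable_pi_apply _)

lemma indep {W : ℝ → Ω → (Fin 2 × Fin 2) → ℝ} (hW : IsStdBM P W) {n : ℕ} (s u : Fin n → ℝ)
    (hs : ∀ k, 0 ≤ s k) (hu : ∀ k, 0 ≤ u k) :
    IndepFun (fun ω k => planarComp W 0 (s k) ω) (fun ω k => planarComp W 1 (u k) ω) P := by
  have := hW.isProb
  set a : Fin (n + n) → ℝ := Fin.append s u with ha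
  have ha0 : ∀ k, 0 ≤ a k := by
    intro k
    refine Fin.addCases (fun i => ?_) (fun i => ?_) k
    · rw [ha, Fin.append_left]; exact hs i
    · rw [ha, Fin.append_right]; exact hu i
  set e := Tuple.sort a
  obtain ⟨ht0, htm⟩ := cons_mono (s := a ∘ e) (fun k => ha0 _) (Tuple.monotone_sort a)
  have hcs := cs_incr hW (a ∘ e)
  set t : Fin (n + n + 1) → ℝ := Fin.cons 0 (a ∘ e) with ht
  have hi := hW.indep_incr _ t ht0 htm
  have hm : ∀ k : Fin (n+n), Measurable (fun ω => W (t k.succ) ω - W (t k.castSucc) ω) :=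
    fun k => (hW.meas _).sub (hW.meas _)
  set X : Fin (n+n) → (Fin 2 × Fin 2) → Ω → ℝ :=
    fun k p ω => W (t k.succ) ω p - W (t k.castSucc) ω p with hX
  have hXm : ∀ k p, Measurable (X k p) := fun k p => (measurable_pi_apply p).comp (hm k)
  have hI : iIndepFun (fun (q : Fin (n+n) × (Fin 2 × Fin 2)) ω => X q.1 q.2 ω) P := by
    refine iIndepFun_uncurry' hXm hi fun k => ?_
    rw [iIndepFun_iff_map_fun_eq_pi_map (fun p => (hXm k p).aemeasurable)]
    have hg := hW.gauss_incr _ _ (ht0 _) (htm (Fin.castSucc_le_succ k))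
    have h2 : ∀ p, P.map (X k p) = gaussianReal 0 (t k.succ - t k.castSucc).toNNReal := by
      intro p
      have := (measurePreserving_eval (fun _ : Fin 2 × Fin 2 =>
        gaussianReal 0 (t k.succ - t k.castSucc).toNNReal) p).map_eq
      rw [← this]
      change _ = (gaussianPi _ _).map _
      rw [← hg, Measure.map_map (measurable_pi_apply p) (hm k)]
      rfl
    simp only [h2]
    exact hg
  let S : Fin 2 → Finset (Fin (n+n) × (Fin 2 × Fin 2)) := fun c => Finset.univ.filter fun q => q.2.1 = c
  have hST := hI.indepFun_finset (S 0) (S 1) (by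
      rw [Finset.disjoint_filter]; intro q _ h; rw [h]; decide) (fun q => hXm _ _)
  have hφ : ∀ (c : Fin 2) (g : Fin n → Fin (n+n)), Measurable
      (fun (d : {q // q ∈ S c} → ℝ) (k : Fin n) (i : Fin 2) => ∑ l : Fin (n+n),
      if l ≤ g k then d ⟨(l, (c, i)), by simp [S]⟩ else 0) := by
    intro c g
    refine measurable_pi_lambda _ fun k => measurable_pi_lambda _ fun i =>
      Finset.measurable_sum _ fun l _ => ?_
    split_ifs
    · exact measurable_pi_apply _
    · exact measurable_const
  have key : ∀ (j : Fin (n+n)) (c i : Fin 2) ω, W (a j) ω (c, i)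
      = ∑ l : Fin (n+n), if l ≤ e.symm j then X l (c, i) ω else 0 := by
    intro j c i ω
    have := congrFun (congrFun (hcs ω) (e.symm j)) (c, i)
    simp only [Function.comp, Equiv.apply_symm_apply] at this
    rw [← this, cs, Finset.sum_apply]
    refine Finset.sum_congr rfl fun l _ => ?_
    split_ifs <;> rfl
  have := hST.comp (hφ 0 fun k => e.symm (Fin.castAdd n k)) (hφ 1 fun k => e.symm (Fin.natAdd n k))
  convert this using 1
  · funext ω k i
    have h := key (Fin.castAdd n k) 0 i ω
    simp only [ha, Fin.append_left] at h
    exact h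
  · funext ω k i
    have h := key (Fin.natAdd n k) 1 i ω
    simp only [ha, Fin.append_right] at h
    exact h

end S10

namespace S10

abbrev cube (n : ℕ) : Set (Fin n → ℝ) := Set.univ.pi fun _ => Set.Icc (0:ℝ) 1

lemma mp_perm {n : ℕ} {E : Type*} [MeasureSpace E] [SigmaFinite (volume : Measure E)]
    (σ : Equiv.Perm (Fin n)) :
    MeasurePreserving (fun z : Fin n → E => z ∘ σ) volume volume := by
  have h := volume_measurePreserving_piCongrLeft (fun _ : Fin n => E) σ.symm
  refine (congrArg (fun F => MeasurePreserving F volume volume) ?_).mpr h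
  funext z i
  obtain ⟨j, rfl⟩ := σ.symm.surjective i
  have := Equiv.piCongrLeft_apply_apply (fun _ : Fin n => E) σ.symm z j
  simp only [Function.comp, Equiv.apply_symm_apply]
  exact this.symm

lemma me_perm {n : ℕ} {E : Type*} [MeasurableSpace E] (σ : Equiv.Perm (Fin n)) :
    Measurable (fun z : Fin n → E => z ∘ σ) :=
  measurable_pi_lambda _ fun _ => measurable_pi_apply _

lemma measurableSet_simplex (n : ℕ) : MeasurableSet (simplex01 n) := by
  have : simplex01 n = (⋂ k, {s : Fin n → ℝ | s k ∈ Set.Icc (0:ℝ) 1}) ∩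
      ⋂ i, ⋂ j, {s : Fin n → ℝ | i < j → s i < s j} := by
    ext s; simp only [simplex01, StrictMono, Set.mem_ofPred_eq, Set.mem_inter_iff, Set.mem_iInter]
  rw [this]
  refine (MeasurableSet.iInter fun k => measurable_pi_apply k measurableSet_Icc).inter
    (MeasurableSet.iInter fun i => MeasurableSet.iInter fun j => ?_)
  by_cases h : i < j
  · simp only [h, true_imp_iff]
    exact measurableSet_lt (measurable_pi_apply i) (measurable_pi_apply j)
  · simp [h]

lemma ae_inj (n : ℕ) : ∀ᵐ s : Fin n → ℝ, Function.Injective s := by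
  have h : ∀ i j : Fin n, i ≠ j → ∀ᵐ s : Fin n → ℝ, s i ≠ s j := by
    intro i j hij
    rw [ae_iff]
    let L : (Fin n → ℝ) →ₗ[ℝ] ℝ := (LinearMap.proj (R := ℝ) (φ := fun _ : Fin n => ℝ) i)
      - LinearMap.proj (R := ℝ) (φ := fun _ : Fin n => ℝ) j
    have hL : ∀ s, L s = s i - s j := fun s => rfl
    have := Measure.addHaar_submodule (volume : Measure (Fin n → ℝ)) (LinearMap.ker L) (by
        intro h
        have h2 : (Pi.single i 1 : Fin n → ℝ) ∈ LinearMap.ker L := by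
          rw [h]; trivial
        rw [LinearMap.mem_ker, hL] at h2
        simp [hij.symm] at h2)
    convert this using 2
    ext s
    simp [hL, sub_eq_zero]
  have h2 : ∀ᵐ s : Fin n → ℝ, ∀ i j : Fin n, i ≠ j → s i ≠ s j := by
    rw [ae_all_iff]; intro i
    rw [ae_all_iff]; intro j
    by_cases hij : i = j
    · simp [hij]
    · filter_upwards [h i j hij] with s hs _ using hs
  filter_upwards [h2] with s hs i j hij
  by_contra hne
  exact hs i j hne hij

lemma cube_split {n : ℕ} (Φ : (Fin n → ℝ) → ℝ≥0∞) (hΦ : Measurable Φ) :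
    ∫⁻ s in cube n, Φ s = ∑ σ : Equiv.Perm (Fin n), ∫⁻ s in simplex01 n, Φ (s ∘ σ.symm) := by
  classical
  have hms := measurableSet_simplex n
  have h1 : ∀ σ : Equiv.Perm (Fin n), ∫⁻ s in simplex01 n, Φ (s ∘ σ.symm)
      = ∫⁻ s, if s ∘ σ ∈ simplex01 n then Φ s else 0 := by
    intro σ
    rw [← lintegral_indicator hms, ← (mp_perm σ).lintegral_comp
      (f := (simplex01 n).indicator fun s => Φ (s ∘ σ.symm)) ((hΦ.comp (me_perm σ.symm)).indicator hms)]
    refine lintegral_congr fun s => ?_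
    simp only [Set.indicator_apply, Function.comp_assoc, Equiv.self_comp_symm, Function.comp_id]
  simp only [h1]
  rw [← lintegral_finsetSum]
  · rw [← lintegral_indicator (MeasurableSet.univ_pi fun _ => measurableSet_Icc)]
    refine lintegral_congr_ae ?_
    filter_upwards [ae_inj n] with s hs
    have hmono : StrictMono (s ∘ Tuple.sort s) :=
      (Tuple.monotone_sort s).strictMono_of_injective (hs.comp (Tuple.sort s).injective)
    rw [Finset.sum_eq_single (Tuple.sort s)]
    · rw [Set.indicator_apply]
      refine if_congr ?_ rfl rfl
      simp only [simplex01, Set.mem_pi, Set.mem_ofPred_eq, Set.mem_univ, true_imp_iff, hmono, and_true]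
      exact ⟨fun h k => h _, fun h k => by simpa using h ((Tuple.sort s).symm k)⟩
    · intro τ _ hne
      refine if_neg fun hτ => hne ?_
      have := Tuple.unique_monotone (f := s) hτ.2.monotone hmono.monotone
      ext k
      exact congrArg _ (hs (congrFun this k))
    · simp
  · intro σ _
    exact Measurable.ite (me_perm σ hms) hΦ measurable_const

noncomputable def dens {n : ℕ} (s : Fin n → ℝ) (z : Fin n → Fin 2 → ℝ) : ℝ≥0∞ :=
  ENNReal.ofReal (∏ k, heatKernel (s k - prv s k) (z k - prv z k))

lemma measurable_dens {n : ℕ} :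
    Measurable (fun p : (Fin n → ℝ) × (Fin n → Fin 2 → ℝ) => dens p.1 p.2) := by
  unfold dens
  refine Measurable.ennreal_ofReal (Finset.measurable_prod _ fun k _ => ?_)
  refine measurable_heat.comp (Measurable.prodMk ?_ ?_)
  · unfold prv; split_ifs <;> fun_prop
  · unfold prv; split_ifs <;> fun_prop

lemma hfun_eq {n : ℕ} (z : Fin n → Fin 2 → ℝ) :
    hfun n z = ∑ σ : Equiv.Perm (Fin n), ∫⁻ s in simplex01 n, dens s (z ∘ σ) := rfl

lemma measurable_dens_perm {n : ℕ} (σ : Equiv.Perm (Fin n)) :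
    Measurable (fun p : (Fin n → Fin 2 → ℝ) × (Fin n → ℝ) => dens p.2 (p.1 ∘ σ)) := by
  have h : Measurable (fun p : (Fin n → Fin 2 → ℝ) × (Fin n → ℝ) => (p.2, p.1 ∘ σ)) :=
    measurable_snd.prodMk ((me_perm σ).comp measurable_fst)
  have h2 := measurable_dens.comp h
  exact h2

lemma measurable_dens_s {n : ℕ} (σ : Equiv.Perm (Fin n)) (z : Fin n → Fin 2 → ℝ) :
    Measurable (fun s : Fin n → ℝ => dens s (z ∘ σ)) := by
  have h := (measurable_dens_perm σ).comp (measurable_prodMk_left (x := z))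
  exact h

lemma measurable_dens_z {n : ℕ} (s : Fin n → ℝ) :
    Measurable (fun z : Fin n → Fin 2 → ℝ => dens s z) := by
  have h := measurable_dens.comp (measurable_prodMk_left (x := s) (β := Fin n → Fin 2 → ℝ))
  exact h

lemma measurable_hfun {n : ℕ} : Measurable (hfun n) := by
  have : hfun n = fun z => ∑ σ : Equiv.Perm (Fin n), ∫⁻ s in simplex01 n, dens s (z ∘ σ) := rfl
  rw [this]
  exact Finset.measurable_sum _ fun σ _ => (measurable_dens_perm σ).lintegral_prod_right'

variable {Ω : Type*} [MeasurableSpace Ω] {P : Measure Ω}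

lemma bm_meas {B : ℝ → Ω → Fin 2 → ℝ} (hB : IsStdBM P B) :
    Measurable (fun p : ℝ × Ω => B p.1 p.2) :=
  measurable_uncurry_of_continuous_of_measurable
    (fun ω => continuous_pi fun i => hB.cont ω i) hB.meas

lemma bm_meas_prod {n : ℕ} {B : ℝ → Ω → Fin 2 → ℝ} (hB : IsStdBM P B)
    (r : (Fin 2 → ℝ) → ℝ≥0∞) (hr : Measurable r) (x : Fin n → Fin 2 → ℝ) :
    Measurable (fun p : (Fin n → ℝ) × Ω => ∏ k, r (B (p.1 k) p.2 - x k)) := by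
  refine Finset.measurable_prod _ fun k _ => hr.comp (Measurable.sub_const ?_ _)
  have h : Measurable (fun p : (Fin n → ℝ) × Ω => (p.1 k, p.2)) :=
    ((measurable_pi_apply k).comp measurable_fst).prodMk measurable_snd
  exact Measurable.comp (bm_meas hB) h

lemma expand {n : ℕ} {B : ℝ → Ω → Fin 2 → ℝ} (hB : IsStdBM P B)
    (r : (Fin 2 → ℝ) → ℝ≥0∞) (hr : Measurable r) (x : Fin n → Fin 2 → ℝ) (ω : Ω) :
    ∏ k, (∫⁻ s in Set.Icc (0:ℝ) 1, r (B s ω - x k))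
      = ∫⁻ s in cube n, ∏ k, r (B (s k) ω - x k) := by
  rw [cube, volume_pi, Measure.restrict_pi_pi]
  refine (lintegral_pi_prod (fun _ : Fin n => (volume : Measure ℝ).restrict (Set.Icc 0 1))
    (fun k s => r (B s ω - x k)) fun k => ?_).symm
  exact hr.comp (((bm_meas hB).comp (measurable_id.prodMk measurable_const)).sub_const _)

lemma moment {n : ℕ} {B : ℝ → Ω → Fin 2 → ℝ} (hB : IsStdBM P B)
    (r : (Fin 2 → ℝ) → ℝ≥0∞) (hr : Measurable r) (x : Fin n → Fin 2 → ℝ) :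
    ∫⁻ ω, ∏ k, (∫⁻ s in Set.Icc (0:ℝ) 1, r (B s ω - x k)) ∂P
      = ∫⁻ z, (∏ k, r (z k - x k)) * hfun n z := by
  have := hB.isProb
  have hA := bm_meas_prod hB r hr x
  simp only [expand hB r hr x]
  rw [lintegral_lintegral_swap (f := fun ω (s : Fin n → ℝ) => ∏ k, r (B (s k) ω - x k)) (hA.comp measurable_swap).aemeasurable]
  rw [cube_split (fun s => ∫⁻ ω, ∏ k, r (B (s k) ω - x k) ∂P) hA.lintegral_prod_right']
  simp only [hfun_eq, Finset.mul_sum]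
  have hQ : Measurable (fun z : Fin n → Fin 2 → ℝ => ∏ k, r (z k - x k)) :=
    Finset.measurable_prod _ fun k _ => hr.comp ((measurable_pi_apply k).sub_const _)
  have hS : ∀ σ : Equiv.Perm (Fin n), Measurable fun z : Fin n → Fin 2 → ℝ =>
      ∫⁻ s in simplex01 n, dens s (z ∘ σ) :=
    fun σ => (measurable_dens_perm σ).lintegral_prod_right'
  rw [lintegral_finsetSum (f := fun (σ : Equiv.Perm (Fin n)) (z : Fin n → Fin 2 → ℝ) =>
    (∏ k, r (z k - x k)) * ∫⁻ s in simplex01 n, dens s (z ∘ σ)) _ fun σ _ => hQ.mul (hS σ)]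
  refine Finset.sum_congr rfl fun σ _ => ?_
  have hst : ∀ z : Fin n → Fin 2 → ℝ, (∏ k, r (z k - x k)) * ∫⁻ s in simplex01 n, dens s (z ∘ σ)
      = ∫⁻ s in simplex01 n, (∏ k, r (z k - x k)) * dens s (z ∘ σ) := by
    intro z
    rw [lintegral_const_mul]
    exact measurable_dens_s σ z
  simp only [hst]
  rw [lintegral_lintegral_swap (f := fun (z : Fin n → Fin 2 → ℝ) (s : Fin n → ℝ) => (∏ k, r (z k - x k)) * dens s (z ∘ σ)) ((hQ.comp measurable_fst).mul (measurable_dens_perm σ)).aemeasurable]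
  have hpos : ∀ᵐ s : Fin n → ℝ, ∀ k, s k ≠ 0 := by
    rw [ae_all_iff]; intro k
    have := (Measure.quasiMeasurePreserving_eval (fun _ : Fin n => (volume : Measure ℝ)) k).ae
      (p := fun y => y ≠ 0) (by simp [ae_iff])
    exact this
  refine setLIntegral_congr_fun_ae (measurableSet_simplex n) ?_
  filter_upwards [hpos] with s hs0 hs
  let G : (Fin n → Fin 2 → ℝ) → ℝ≥0∞ := fun z => ∏ k, r (z (σ.symm k) - x k)
  have hG : Measurable G := hQ.comp (me_perm σ.symm)
  have hl := law hB s (fun k => lt_of_le_of_ne (hs.1 k).1 (hs0 k).symm) hs.2 G hG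
  refine hl.trans ?_
  have hd : Measurable fun z : Fin n → Fin 2 → ℝ => G z * dens s z :=
    hG.mul (measurable_dens_z s)
  refine ((mp_perm σ).lintegral_comp hd).symm.trans ?_
  refine lintegral_congr fun z => ?_
  simp [G]

lemma factor_aux {S : Type*} [MeasurableSpace S] (ν : Measure S) [SFinite ν] [SFinite P]
    (A C : S → Ω → ℝ≥0∞) (hA : Measurable (Function.uncurry A)) (hC : Measurable (Function.uncurry C))
    (h : ∀ᵐ s ∂ν, ∀ᵐ u ∂ν, ∫⁻ ω, A s ω * C u ω ∂P = (∫⁻ ω, A s ω ∂P) * ∫⁻ ω, C u ω ∂P) :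
    ∫⁻ ω, (∫⁻ s, A s ω ∂ν) * (∫⁻ u, C u ω ∂ν) ∂P
      = (∫⁻ ω, ∫⁻ s, A s ω ∂ν ∂P) * ∫⁻ ω, ∫⁻ u, C u ω ∂ν ∂P := by
  have hA' : ∀ ω, Measurable fun s => A s ω := fun ω => hA.of_uncurry_right
  have hC' : ∀ ω, Measurable fun s => C s ω := fun ω => hC.of_uncurry_right
  have hAs : Measurable (Function.uncurry fun ω s => A s ω) := hA.comp measurable_swap
  have hCs : Measurable (Function.uncurry fun ω s => C s ω) := hC.comp measurable_swap
  have hC2 : Measurable fun ω => ∫⁻ u, C u ω ∂ν := hCs.lintegral_prod_right'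
  have hA2 : Measurable fun s => ∫⁻ ω, A s ω ∂P := hA.lintegral_prod_right'
  simp only [← lintegral_mul_const _ (hA' _)]
  rw [lintegral_lintegral_swap (f := fun ω s => A s ω * ∫⁻ u, C u ω ∂ν)
      ((hAs.mul (hC2.comp measurable_fst)).aemeasurable),
    lintegral_lintegral_swap (f := fun ω s => A s ω) hAs.aemeasurable,
    lintegral_lintegral_swap (f := fun ω s => C s ω) hCs.aemeasurable,
    ← lintegral_mul_const _ hA2]
  refine lintegral_congr_ae ?_
  filter_upwards [h] with s hs
  simp only [← lintegral_const_mul _ (hC' _)]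
  have hC3 : Measurable fun u => ∫⁻ ω, C u ω ∂P := hC.lintegral_prod_right'
  rw [← lintegral_const_mul _ hC3]
  rw [lintegral_lintegral_swap (f := fun ω u => A s ω * C u ω)]
  · exact lintegral_congr_ae hs
  · have hAf : Measurable fun p : Ω × S => A s p.1 := hA.of_uncurry_left.comp measurable_fst
    exact (hAf.mul hCs).aemeasurable

lemma factor {W : ℝ → Ω → (Fin 2 × Fin 2) → ℝ} (hW : IsStdBM P W) {n : ℕ}
    (r : (Fin 2 → ℝ) → ℝ≥0∞) (hr : Measurable r) (x : Fin n → Fin 2 → ℝ) :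
    ∫⁻ ω, (∏ k, (∫⁻ s in Set.Icc (0:ℝ) 1, r (planarComp W 0 s ω - x k)))
        * (∏ k, (∫⁻ s in Set.Icc (0:ℝ) 1, r (planarComp W 1 s ω - x k))) ∂P
      = (∫⁻ ω, (∏ k, (∫⁻ s in Set.Icc (0:ℝ) 1, r (planarComp W 0 s ω - x k))) ∂P)
        * ∫⁻ ω, (∏ k, (∫⁻ s in Set.Icc (0:ℝ) 1, r (planarComp W 1 s ω - x k))) ∂P := by
  have := hW.isProb
  simp only [expand (planar hW 0) r hr x, expand (planar hW 1) r hr x]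
  have hA := bm_meas_prod (planar hW 0) r hr x
  have hC := bm_meas_prod (planar hW 1) r hr x
  have hcm : MeasurableSet (cube n) := MeasurableSet.univ_pi fun _ => measurableSet_Icc
  refine factor_aux (volume.restrict (cube n)) (fun s ω => ∏ k, r (planarComp W 0 (s k) ω - x k))
    (fun s ω => ∏ k, r (planarComp W 1 (s k) ω - x k)) hA hC ?_
  filter_upwards [ae_restrict_mem hcm] with s hs
  filter_upwards [ae_restrict_mem hcm] with u hu
  have hQ : Measurable (fun z : Fin n → Fin 2 → ℝ => ∏ k, r (z k - x k)) :=
    Finset.measurable_prod _ fun k _ => hr.comp ((measurable_pi_apply k).sub_const _)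
  have h1 : Measurable fun ω => ∏ k, r (planarComp W 0 (s k) ω - x k) := by
    have h := hA.comp (measurable_prodMk_left (x := s)); exact h
  have h2 : Measurable fun ω => ∏ k, r (planarComp W 1 (u k) ω - x k) := by
    have h := hC.comp (measurable_prodMk_left (x := u)); exact h
  refine lintegral_mul_eq_lintegral_mul_lintegral_of_indepFun h1 h2 ?_
  exact (indep hW s u (fun k => (hs k trivial).1) (fun k => (hu k trivial).1)).comp hQ hQ

end S10

namespace S10

lemma sq_le {α : Type*} [MeasurableSpace α] (μ : Measure α) (q h : α → ℝ≥0∞) (hq : Measurable q)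
    (hh : Measurable h) (h1 : ∫⁻ a, q a ∂μ = 1) :
    (∫⁻ a, q a * h a ∂μ) ^ 2 ≤ ∫⁻ a, q a * h a ^ 2 ∂μ := by
  have hH := ENNReal.lintegral_mul_le_Lp_mul_Lq (μ.withDensity q) Real.HolderConjugate.two_two
    (f := fun _ => 1) (g := h) aemeasurable_const hh.aemeasurable
  rw [lintegral_withDensity_eq_lintegral_mul _ hq (by simpa using! measurable_const.mul hh)] at hH
  have e1 : ∫⁻ a, (1:ℝ≥0∞) ^ (2:ℝ) ∂μ.withDensity q = 1 := by
    simp [withDensity_apply _ MeasurableSet.univ, h1]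
  rw [e1] at hH
  simp only [ENNReal.one_rpow, one_mul, Pi.mul_apply, ENNReal.rpow_two] at hH
  rw [lintegral_withDensity_eq_lintegral_mul _ hq (hh.pow_const 2)] at hH
  simp only [Pi.mul_apply] at hH
  calc (∫⁻ a, q a * h a ∂μ) ^ 2 ≤ ((∫⁻ a, q a * h a ^ 2 ∂μ) ^ (1 / (2:ℝ))) ^ 2 := by gcongr
    _ = _ := by
      rw [← ENNReal.rpow_natCast, ← ENNReal.rpow_mul]; simp

section
variable {ρ R : (Fin 2 → ℝ) → ℝ} (hρc : Continuous ρ) (hρnn : ∀ x, 0 ≤ ρ x)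
    (hρe : ∀ x, ρ (-x) = ρ x) (hρsupp : HasCompactSupport ρ)
    (hρ1 : (∫ x : Fin 2 → ℝ, ρ x) = 1)
    (hR : ∀ x, R x = ∫ y : Fin 2 → ℝ, ρ (x - y) * ρ y) {ε : ℝ} (hε : 0 < ε)

lemma moll_cont {f : (Fin 2 → ℝ) → ℝ} (hf : Continuous f) (ε : ℝ) : Continuous (mollify f ε) := by
  unfold mollify; fun_prop

lemma moll_nonneg {f : (Fin 2 → ℝ) → ℝ} (hf : ∀ x, 0 ≤ f x) (ε : ℝ) (x) : 0 ≤ mollify f ε x :=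
  mul_nonneg (by positivity) (hf _)

include hρc hρsupp hε in
lemma moll_supp : HasCompactSupport (mollify ρ ε) := by
  unfold mollify
  exact (hρsupp.comp_smul (inv_ne_zero hε.ne')).mul_left

include hρc hρnn hρsupp hρ1 hε in
lemma moll_int : ∫⁻ x, ENNReal.ofReal (mollify ρ ε x) = 1 := by
  rw [← ofReal_integral_eq_lintegral_ofReal
    ((moll_cont hρc ε).integrable_of_hasCompactSupport (moll_supp hρc hρsupp hε))
    (ae_of_all _ (moll_nonneg hρnn ε))]
  unfold mollify
  rw [integral_const_mul, Measure.integral_comp_smul, hρ1]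
  simp
  rw [inv_mul_cancel₀]
  positivity

include hρc hρsupp hR in
lemma R_cont : Continuous R := by
  have h := HasCompactSupport.continuous_convolution_right (ContinuousLinearMap.mul ℝ ℝ) (μ := volume)
    hρsupp (hρc.locallyIntegrable) hρc
  convert h using 1
  ext x
  rw [hR x, convolution]
  refine integral_congr_ae (ae_of_all _ fun y => ?_)
  simp [mul_comm]

include hρnn hR in
lemma R_nonneg (x) : 0 ≤ R x := by
  rw [hR]; exact integral_nonneg fun y => mul_nonneg (hρnn _) (hρnn _)

include hρc hρnn hρe hρsupp hR hε in
lemma moll_R (x y : Fin 2 → ℝ) : ENNReal.ofReal (mollify R ε (x - y))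
    = ∫⁻ z, ENNReal.ofReal (mollify ρ ε (x - z)) * ENNReal.ofReal (mollify ρ ε (y - z)) := by
  simp only [← ENNReal.ofReal_mul (moll_nonneg hρnn ε _)]
  rw [← ofReal_integral_eq_lintegral_ofReal]
  · congr 1
    have h1 := integral_add_left_eq_self (μ := volume)
      (fun z => mollify ρ ε (x - z) * mollify ρ ε (y - z)) y
    have h2 := Measure.integral_comp_smul volume
      (fun z => mollify ρ ε (x - (y + z)) * mollify ρ ε (y - (y + z))) ε
    rw [h1] at h2
    have h3 : ∀ z : Fin 2 → ℝ, mollify ρ ε (x - (y + ε • z)) * mollify ρ ε (y - (y + ε • z))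
        = ((ε ^ 2)⁻¹ * (ε ^ 2)⁻¹) * (ρ (ε⁻¹ • (x - y) - z) * ρ z) := by
      intro z
      unfold mollify
      have e1 : ε⁻¹ • (x - (y + ε • z)) = ε⁻¹ • (x - y) - z := by
        rw [← sub_sub, smul_sub, smul_smul, inv_mul_cancel₀ hε.ne', one_smul]
      have e2 : ε⁻¹ • (y - (y + ε • z)) = - z := by
        rw [sub_add_cancel_left, smul_neg, smul_smul, inv_mul_cancel₀ hε.ne', one_smul]
      rw [e1, e2, hρe]
      ring
    simp only [h3] at h2
    rw [integral_const_mul, ← hR] at h2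
    unfold mollify at h2 ⊢
    simp only [Module.finrank_fintype_fun_eq_card, Fintype.card_fin, smul_eq_mul] at h2
    rw [abs_of_pos (by positivity), mul_assoc] at h2
    exact mul_left_cancel₀ (by positivity) h2
  · refine Continuous.integrable_of_hasCompactSupport ?_ ?_
    · have := moll_cont hρc ε
      fun_prop
    · refine HasCompactSupport.mul_right ?_
      exact (moll_supp hρc hρsupp hε).comp_homeomorph (Homeomorph.subLeft x)
  · exact ae_of_all _ fun z => mul_nonneg (moll_nonneg hρnn ε _) (moll_nonneg hρnn ε _)

end
end S10

namespace S10

lemma second {n : ℕ} (r : (Fin 2 → ℝ) → ℝ≥0∞) (hr : Measurable r) (h1 : ∫⁻ a, r a = 1) :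
    (∫⁻ x : Fin n → Fin 2 → ℝ, (∫⁻ z : Fin n → Fin 2 → ℝ, (∏ k, r (z k - x k)) * hfun n z) ^ 2)
      ≤ ∫⁻ x : Fin n → Fin 2 → ℝ, (hfun n x) ^ 2 := by
  have hQ : Measurable (fun p : (Fin n → Fin 2 → ℝ) × (Fin n → Fin 2 → ℝ) =>
      ∏ k, r (p.2 k - p.1 k)) :=
    Finset.measurable_prod _ fun k _ => hr.comp
      (((measurable_pi_apply k).comp measurable_snd).sub ((measurable_pi_apply k).comp measurable_fst))
  have hQx : ∀ x : Fin n → Fin 2 → ℝ, Measurable (fun z : Fin n → Fin 2 → ℝ => ∏ k, r (z k - x k)) := by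
    intro x
    exact Finset.measurable_prod _ fun k _ => hr.comp ((measurable_pi_apply k).sub_const _)
  have hQz : ∀ z : Fin n → Fin 2 → ℝ, Measurable (fun x : Fin n → Fin 2 → ℝ => ∏ k, r (z k - x k)) := by
    intro x
    exact Finset.measurable_prod _ fun k _ => hr.comp ((measurable_pi_apply k).const_sub _)
  have i1 : ∀ x : Fin n → Fin 2 → ℝ, ∫⁻ z : Fin n → Fin 2 → ℝ, ∏ k, r (z k - x k) = 1 := by
    intro x
    refine (lintegral_pi_prod (fun _ : Fin n => (volume : Measure (Fin 2 → ℝ)))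
      (fun k a => r (a - x k)) fun k => hr.comp (measurable_id.sub_const _)).trans ?_
    simp only [lintegral_sub_right_eq_self, h1, Finset.prod_const_one]
  have i2 : ∀ z : Fin n → Fin 2 → ℝ, ∫⁻ x : Fin n → Fin 2 → ℝ, ∏ k, r (z k - x k) = 1 := by
    intro z
    refine (lintegral_pi_prod (fun _ : Fin n => (volume : Measure (Fin 2 → ℝ)))
      (fun k a => r (z k - a)) fun k => hr.comp (measurable_id.const_sub _)).trans ?_
    simp only [lintegral_sub_left_eq_self, h1, Finset.prod_const_one]
  have hh : Measurable (fun z : Fin n → Fin 2 → ℝ => hfun n z ^ 2) := measurable_hfun.pow_const 2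
  calc _ ≤ ∫⁻ x : Fin n → Fin 2 → ℝ, ∫⁻ z : Fin n → Fin 2 → ℝ,
        (∏ k, r (z k - x k)) * hfun n z ^ 2 :=
        lintegral_mono fun x => sq_le _ _ _ (hQx x) measurable_hfun (i1 x)
    _ = ∫⁻ z : Fin n → Fin 2 → ℝ, ∫⁻ x : Fin n → Fin 2 → ℝ,
        (∏ k, r (z k - x k)) * hfun n z ^ 2 :=
        lintegral_lintegral_swap (f := fun (x z : Fin n → Fin 2 → ℝ) =>
          (∏ k, r (z k - x k)) * hfun n z ^ 2) (hQ.mul (hh.comp measurable_snd)).aemeasurable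
    _ = _ := by
        refine lintegral_congr fun z => ?_
        rw [lintegral_mul_const _ (hQz z), i2, one_mul]

lemma F_meas {Ω : Type*} [MeasurableSpace Ω] {P : Measure Ω} {B : ℝ → Ω → Fin 2 → ℝ}
    (hB : IsStdBM P B) (r : (Fin 2 → ℝ) → ℝ≥0∞) (hr : Measurable r) :
    Measurable (fun p : Ω × (Fin 2 → ℝ) => ∫⁻ s in Set.Icc (0:ℝ) 1, r (B s p.1 - p.2)) := by
  have h : Measurable (fun q : (Ω × (Fin 2 → ℝ)) × ℝ => r (B q.2 q.1.1 - q.1.2)) := by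
    refine hr.comp (Measurable.sub ?_ (measurable_snd.comp measurable_fst))
    have h2 : Measurable (fun q : (Ω × (Fin 2 → ℝ)) × ℝ => (q.2, q.1.1)) :=
      measurable_snd.prodMk (measurable_fst.comp measurable_fst)
    have h3 := (bm_meas hB).comp h2
    exact h3
  exact h.lintegral_prod_right'

lemma first {Ω : Type*} [MeasurableSpace Ω] {P : Measure Ω}
    {W : ℝ → Ω → (Fin 2 × Fin 2) → ℝ} (hW : IsStdBM P W) {n : ℕ}
    (r : (Fin 2 → ℝ) → ℝ≥0∞) (hr : Measurable r) :
    ∫⁻ ω, (∫⁻ z, (∫⁻ s in Set.Icc (0:ℝ) 1, r (planarComp W 0 s ω - z))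
      * (∫⁻ s in Set.Icc (0:ℝ) 1, r (planarComp W 1 s ω - z))) ^ n ∂P
    = ∫⁻ x : Fin n → Fin 2 → ℝ, (∫⁻ z : Fin n → Fin 2 → ℝ, (∏ k, r (z k - x k)) * hfun n z) ^ 2 := by
  have := hW.isProb
  have hF := fun c => F_meas (planar hW c) r hr
  have hFω : ∀ c ω, Measurable fun z => ∫⁻ s in Set.Icc (0:ℝ) 1, r (planarComp W c s ω - z) := by
    intro c ω
    have h := (hF c).comp (measurable_prodMk_left (x := ω))
    exact h
  have e1 : ∀ ω, (∫⁻ z, (∫⁻ s in Set.Icc (0:ℝ) 1, r (planarComp W 0 s ω - z))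
      * (∫⁻ s in Set.Icc (0:ℝ) 1, r (planarComp W 1 s ω - z))) ^ n
      = ∫⁻ x : Fin n → Fin 2 → ℝ, (∏ k, (∫⁻ s in Set.Icc (0:ℝ) 1, r (planarComp W 0 s ω - x k)))
        * (∏ k, (∫⁻ s in Set.Icc (0:ℝ) 1, r (planarComp W 1 s ω - x k))) := by
    intro ω
    have := lintegral_pi_prod (fun _ : Fin n => (volume : Measure (Fin 2 → ℝ)))
      (fun _ z => (∫⁻ s in Set.Icc (0:ℝ) 1, r (planarComp W 0 s ω - z))
      * (∫⁻ s in Set.Icc (0:ℝ) 1, r (planarComp W 1 s ω - z))) (fun _ => (hFω 0 ω).mul (hFω 1 ω))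
    simp only [Finset.prod_mul_distrib, Finset.prod_const, Finset.card_univ, Fintype.card_fin] at this
    exact this.symm
  have hprod : ∀ c, Measurable fun p : Ω × (Fin n → Fin 2 → ℝ) =>
      ∏ k, (∫⁻ s in Set.Icc (0:ℝ) 1, r (planarComp W c s p.1 - p.2 k)) := by
    intro c
    refine Finset.measurable_prod _ fun k _ => ?_
    have h2 : Measurable (fun q : Ω × (Fin n → Fin 2 → ℝ) => (q.1, q.2 k)) :=
      measurable_fst.prodMk ((measurable_pi_apply k).comp measurable_snd)
    have h3 := (hF c).comp h2
    exact h3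
  simp only [e1]
  rw [lintegral_lintegral_swap (f := fun ω (x : Fin n → Fin 2 → ℝ) =>
    (∏ k, (∫⁻ s in Set.Icc (0:ℝ) 1, r (planarComp W 0 s ω - x k)))
        * (∏ k, (∫⁻ s in Set.Icc (0:ℝ) 1, r (planarComp W 1 s ω - x k))))
    ((hprod 0).mul (hprod 1)).aemeasurable]
  refine lintegral_congr fun x => ?_
  rw [factor hW r hr x, moment (planar hW 0) r hr x, moment (planar hW 1) r hr x, sq]

lemma alpha_eq {Ω : Type*} [MeasurableSpace Ω] {P : Measure Ω}
    {W : ℝ → Ω → (Fin 2 × Fin 2) → ℝ} (hW : IsStdBM P W) {R : (Fin 2 → ℝ) → ℝ} (hRc : Continuous R)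
    (hR0 : ∀ x, 0 ≤ R x) (ε : ℝ) (r : (Fin 2 → ℝ) → ℝ≥0∞) (hr : Measurable r)
    (hRr : ∀ x y, ENNReal.ofReal (mollify R ε (x - y)) = ∫⁻ z, r (x - z) * r (y - z)) (ω : Ω) :
    ENNReal.ofReal (alphaSet R ε (planarComp W 0) (planarComp W 1)
        (Set.Icc 0 1 ×ˢ Set.Icc 0 1) ω)
    = ∫⁻ z, (∫⁻ s in Set.Icc (0:ℝ) 1, r (planarComp W 0 s ω - z))
      * (∫⁻ s in Set.Icc (0:ℝ) 1, r (planarComp W 1 s ω - z)) := by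
  unfold alphaSet
  have hc : ∀ c, Continuous fun t => planarComp W c t ω :=
    fun c => continuous_pi fun i => (planar hW c).cont ω i
  have hcont : Continuous fun p : ℝ × ℝ => mollify R ε (planarComp W 0 p.2 ω - planarComp W 1 p.1 ω) :=
    (moll_cont hRc ε).comp (((hc 0).comp continuous_snd).sub ((hc 1).comp continuous_fst))
  rw [ofReal_integral_eq_lintegral_ofReal
    (hcont.continuousOn.integrableOn_compact (isCompact_Icc.prod isCompact_Icc))
    (ae_of_all _ fun p => moll_nonneg hR0 ε _)]
  simp only [hRr]
  have hcm := fun c => (hc c).measurable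
  have hm : ∀ c, Measurable fun q : ℝ × (Fin 2 → ℝ) => r (planarComp W c q.1 ω - q.2) :=
    fun c => hr.comp (((hcm c).comp measurable_fst).sub measurable_snd)
  have hm1 : ∀ c z, Measurable fun s : ℝ => r (planarComp W c s ω - z) :=
    fun c z => hr.comp ((hcm c).sub_const _)
  have g1 : Measurable fun q : (ℝ × ℝ) × (Fin 2 → ℝ) => (q.1.2, q.2) := by fun_prop
  have g2 : Measurable fun q : (ℝ × ℝ) × (Fin 2 → ℝ) => (q.1.1, q.2) := by fun_prop
  rw [lintegral_lintegral_swap (f := fun (p : ℝ × ℝ) z =>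
    r (planarComp W 0 p.2 ω - z) * r (planarComp W 1 p.1 ω - z))
    (((hm 0).comp g1).mul ((hm 1).comp g2)).aemeasurable]
  refine lintegral_congr fun z => ?_
  rw [Measure.volume_eq_prod, ← Measure.prod_restrict, lintegral_prod]
  · rw [lintegral_congr fun u => lintegral_mul_const (r (planarComp W 1 u ω - z)) (hm1 0 z)]
    rw [lintegral_const_mul _ (hm1 1 z)]
  · exact (((hm1 0 z).comp measurable_snd).mul ((hm1 1 z).comp measurable_fst)).aemeasurable

end S10

/-- `E[Y_ε^n] = ∫_{ℝ^{2n}} (Q_ε ⋆ h_n)(x)² dx ≤ ∫_{ℝ^{2n}} h_n(x)² dx`, where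
`Y_ε = α_ε([0,1]²)` for two independent planar Brownian motions (the two planar
components of a standard BM `W` in `ℝ⁴`), `Q_ε(z₁,…,zₙ) = ∏_k ρ_ε(z_k)`, and the
convolution is written as `(Q_ε ⋆ h_n)(x) = ∫ ∏_k ρ_ε(z_k - x_k) · h_n(z) dz`. -/
theorem stmt_10 (ρ R : (Fin 2 → ℝ) → ℝ) (hρc : Continuous ρ) (hρnn : ∀ x, 0 ≤ ρ x)
    (hρe : ∀ x, ρ (-x) = ρ x) (hρsupp : HasCompactSupport ρ)
    (hρ1 : (∫ x : Fin 2 → ℝ, ρ x) = 1)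
    (hR : ∀ x, R x = ∫ y : Fin 2 → ℝ, ρ (x - y) * ρ y)
    (Ω : Type*) [MeasurableSpace Ω] (P : Measure Ω)
    (W : ℝ → Ω → (Fin 2 × Fin 2) → ℝ) (hW : IsStdBM P W)
    (n : ℕ) (ε : ℝ) (hε : 0 < ε) :
    (∫⁻ ω, ENNReal.ofReal (alphaSet R ε (planarComp W 0) (planarComp W 1)
        (Set.Icc 0 1 ×ˢ Set.Icc 0 1) ω) ^ n ∂P)
      = (∫⁻ x : Fin n → Fin 2 → ℝ,
          (∫⁻ z : Fin n → Fin 2 → ℝ,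
            ENNReal.ofReal (∏ k : Fin n, mollify ρ ε (z k - x k)) * hfun n z) ^ 2) ∧
    (∫⁻ x : Fin n → Fin 2 → ℝ,
        (∫⁻ z : Fin n → Fin 2 → ℝ,
          ENNReal.ofReal (∏ k : Fin n, mollify ρ ε (z k - x k)) * hfun n z) ^ 2)
      ≤ ∫⁻ x : Fin n → Fin 2 → ℝ, (hfun n x) ^ 2 := by
  have hrm : Measurable fun x => ENNReal.ofReal (mollify ρ ε x) :=
    (S10.moll_cont hρc ε).measurable.ennreal_ofReal
  have hp : ∀ z x : Fin n → Fin 2 → ℝ, ENNReal.ofReal (∏ k : Fin n, mollify ρ ε (z k - x k))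
      = ∏ k : Fin n, ENNReal.ofReal (mollify ρ ε (z k - x k)) := fun z x =>
    ENNReal.ofReal_prod_of_nonneg fun k _ => S10.moll_nonneg hρnn ε _
  simp only [hp]
  refine ⟨?_, S10.second _ hrm (S10.moll_int hρc hρnn hρsupp hρ1 hε)⟩
  rw [← S10.first hW _ hrm]
  refine lintegral_congr fun ω => ?_
  rw [S10.alpha_eq hW (S10.R_cont hρc hρsupp hR) (S10.R_nonneg hρnn hR) ε _ hrm
    (S10.moll_R hρc hρnn hρe hρsupp hR hε)]
end

section
/- Let $B$ be a standard Brownian motion in $\mathbb{R}^3$ started at the origin, let $R : \mathbb{R}^3 \to \mathbb{R}$ be a continuous nonnegative function with $R(x) \ge \delta > 0$ for all $|x| \le 2$, set $R_\varepsilon(x) = \varepsilon^{-3} R(x/\varepsilon)$, and let $C_\varepsilon = c_1 \varepsilon^{-1} + c_2 \log \varepsilon^{-1} + c_3$ for arbitrary constants $c_1, c_2, c_3 \in \mathbb{R}$. Then for every $t > 0$, $\lim_{\varepsilon \to 0^+} e^{-C_\varepsilon t}\, \mathbb{E}_{\mathbf{B}}\Big[ \exp\Big( \int_0^t \int_0^s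 R_\varepsilon(B_s - B_u)\, du\, ds \Big) \Big] = \infty$. -/
open MeasureTheory ProbabilityTheory Real Filter Set

lemma aux_gauss_lower (h r : ℝ) (hh : 0 < h) (hr : 0 ≤ r) (hrh : r ^ 2 ≤ 2 * h) :
    ENNReal.ofReal (2 * r * ((√(2 * π * h))⁻¹ * Real.exp (-1))) ≤
      gaussianReal 0 h.toNNReal (Icc (-r) r) := by
  have hv : h.toNNReal ≠ 0 := by simpa using hh
  rw [gaussianReal_apply _ hv]
  calc _ = ∫⁻ x in Icc (-r) r, ENNReal.ofReal ((√(2 * π * h))⁻¹ * Real.exp (-1)) := by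
        rw [setLIntegral_const, Real.volume_Icc, ← ENNReal.ofReal_mul (by positivity)]
        congr 1; ring
    _ ≤ _ := by
        apply setLIntegral_mono' measurableSet_Icc
        intro x hx
        rw [gaussianPDF]
        apply ENNReal.ofReal_le_ofReal
        rw [gaussianPDFReal_def]
        simp only [Real.coe_toNNReal _ hh.le, sub_zero]
        gcongr
        rw [neg_div, neg_le_neg_iff, div_le_one (by positivity)]
        have : x ^ 2 ≤ r ^ 2 := sq_le_sq' hx.1 hx.2
        linarith

lemma aux_gauss_tail (v h a : ℝ) (hv : v ≤ h) (hh : 0 < h) (ha : 0 < a) :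
    gaussianReal 0 v.toNNReal {x | a < |x|} ≤
      ENNReal.ofReal (2 * Real.exp (-(a ^ 2 / (2 * h)))) := by
  set μ := gaussianReal 0 v.toNNReal
  have hvn : (v.toNNReal : ℝ) ≤ h := by
    rw [Real.coe_toNNReal']; exact max_le hv hh.le
  have hm : ∀ l : ℝ, mgf (fun x => x) μ l ≤ Real.exp (h * l ^ 2 / 2) := by
    intro l
    rw [mgf_fun_id_gaussianReal]
    simp only [zero_mul, zero_add]
    gcongr
  have e1 : ∀ l : ℝ, l ^ 2 = (a / h) ^ 2 → -(a / h) * a + h * l ^ 2 / 2 = -(a ^ 2 / (2 * h)) := by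
    intro l hl; rw [hl]; field_simp; ring
  have h1 : μ.real {x | a ≤ x} ≤ Real.exp (-(a ^ 2 / (2 * h))) := by
    refine (measure_ge_le_exp_mul_mgf (X := fun x => x) a (t := a / h) (by positivity)
      (integrable_exp_mul_gaussianReal _)).trans ?_
    rw [← e1 (a / h) rfl, Real.exp_add]
    gcongr
    exact hm _
  have h2 : μ.real {x | x ≤ -a} ≤ Real.exp (-(a ^ 2 / (2 * h))) := by
    refine (measure_le_le_exp_mul_mgf (X := fun x => x) (-a) (t := -(a / h))
      (by rw [neg_nonpos]; positivity)
      (integrable_exp_mul_gaussianReal _)).trans ?_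
    rw [← e1 (-(a / h)) (by ring), Real.exp_add, show - -(a / h) * -a = -(a / h) * a by ring]
    gcongr
    exact hm _
  have hs : {x : ℝ | a < |x|} ⊆ {x | a ≤ x} ∪ {x | x ≤ -a} := by
    intro x hx
    rcases lt_abs.1 (show a < |x| from hx) with h | h
    · left; exact h.le
    · right; show x ≤ -a; linarith
  rw [← ENNReal.ofReal_toReal (measure_ne_top μ {x | a < |x|})]
  apply ENNReal.ofReal_le_ofReal
  have := (measureReal_mono (μ := μ) hs).trans (measureReal_union_le _ _)
  change μ.real _ ≤ _
  linarith

def boxS (r : ℝ) : Set (Fin 3 → ℝ) := {x | ∀ i, |x i| ≤ r}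
def boxC (r : ℝ) : Set (Fin 3 → ℝ) := {x | ∃ i, r < |x i|}

lemma meas_boxS (r : ℝ) : MeasurableSet (boxS r) := by
  unfold boxS
  simp only [ofPred_forall]
  exact MeasurableSet.iInter fun i => measurableSet_le (by fun_prop) (by fun_prop)

lemma meas_boxC (r : ℝ) : MeasurableSet (boxC r) := by
  unfold boxC
  simp only [ofPred_exists]
  exact MeasurableSet.iUnion fun i => measurableSet_lt (by fun_prop) (by fun_prop)

lemma aux_box_lower (h r : ℝ) (hh : 0 < h) (hr : 0 ≤ r) (hrh : r ^ 2 ≤ 2 * h) :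
    ENNReal.ofReal ((2 * r * ((√(2 * π * h))⁻¹ * Real.exp (-1))) ^ 3) ≤
      gaussianPi (Fin 3) h.toNNReal (boxS r) := by
  have : boxS r = Set.pi univ (fun _ => Icc (-r) r) := by
    ext x; simp [boxS, abs_le, Pi.le_def, forall_and]
  rw [this, gaussianPi, Measure.pi_pi, Finset.prod_const, ENNReal.ofReal_pow (by positivity)]
  simp only [Finset.card_univ, Fintype.card_fin]
  gcongr
  exact aux_gauss_lower h r hh hr hrh

lemma aux_box_tail (v h a : ℝ) (hv : v ≤ h) (hh : 0 < h) (ha : 0 < a) :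
    gaussianPi (Fin 3) v.toNNReal (boxC a) ≤
      ENNReal.ofReal (6 * Real.exp (-(a ^ 2 / (2 * h)))) := by
  have e : boxC a = ⋃ i : Fin 3, (Function.eval i) ⁻¹' {x : ℝ | a < |x|} := by
    ext x; simp [boxC]
  rw [e]
  refine (measure_iUnion_fintype_le _ _).trans ?_
  have : ∀ i : Fin 3, gaussianPi (Fin 3) v.toNNReal ((Function.eval i) ⁻¹' {x : ℝ | a < |x|})
      ≤ ENNReal.ofReal (2 * Real.exp (-(a ^ 2 / (2 * h)))) := by
    intro i
    rw [gaussianPi, (measurePreserving_eval _ i).measure_preimage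
      (measurableSet_lt (by fun_prop) (by fun_prop)).nullMeasurableSet]
    exact aux_gauss_tail v h a hv hh ha
  refine (Finset.sum_le_sum fun i _ => this i).trans ?_
  simp only [Finset.sum_const, Finset.card_univ, Fintype.card_fin]
  rw [← ENNReal.ofReal_nsmul]
  apply ENNReal.ofReal_le_ofReal
  rw [nsmul_eq_mul]
  push_cast
  linarith

section BM
variable {Ω : Type*} [MeasurableSpace Ω] {P : Measure Ω} {B : ℝ → Ω → Fin 3 → ℝ}

lemma aux_indep (hB : IsStdBM P B) (q : ℕ → ℝ) (hq : ∀ i, 0 ≤ q i) (hm : Monotone q) (n : ℕ)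
    (F : ℕ → Set (Fin 3 → ℝ)) (hF : ∀ i, MeasurableSet (F i)) :
    P {ω | ∀ k < n, B (q (k + 1)) ω - B (q k) ω ∈ F k} =
      ∏ k ∈ Finset.range n, gaussianPi (Fin 3) (q (k + 1) - q k).toNNReal (F k) := by
  have h1 := (hB.indep_incr n (fun i => q i) (fun i => hq _)
    (fun i j hij => hm (by exact_mod_cast hij))).measure_inter_preimage_eq_mul Finset.univ
    (sets := fun k => F k) (fun i _ => hF _)
  rw [Finset.prod_range]
  have e : {ω | ∀ k < n, B (q (k + 1)) ω - B (q k) ω ∈ F k} =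
    ⋂ i ∈ (Finset.univ : Finset (Fin n)), (fun ω => B (q (i.succ : Fin (n+1))) ω -
      B (q (i.castSucc : Fin (n+1))) ω) ⁻¹' F i := by
    ext ω
    simp only [mem_ofPred_eq, mem_iInter, mem_preimage, Fin.val_succ, Fin.val_castSucc]
    exact ⟨fun h i _ => h i i.2, fun h k hk => h ⟨k, hk⟩ (Finset.mem_univ _)⟩
  rw [e, h1]
  refine Finset.prod_congr rfl fun i _ => ?_
  rw [← hB.gauss_incr _ _ (hq _) (hm (Nat.le_succ _)),
    Measure.map_apply (show Measurable (fun ω => B (q (Nat.succ i)) ω - B (q i) ω) from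
      (hB.meas _).sub (hB.meas _)) (hF _)]
  simp

def evA (B : ℝ → Ω → Fin 3 → ℝ) (h r : ℝ) (N : ℕ) : Set Ω :=
  {ω | ∀ k < N, B ((k + 1 : ℕ) * h) ω - B (k * h) ω ∈ boxS r}

lemma aux_PA (hB : IsStdBM P B) (h r : ℝ) (hh : 0 ≤ h) (N : ℕ) :
    P (evA B h r N) = gaussianPi (Fin 3) h.toNNReal (boxS r) ^ N := by
  have := aux_indep hB (fun i => i * h) (fun i => by positivity)
    (fun i j hij => by dsimp only; gcongr) N (fun _ => boxS r) (fun _ => meas_boxS r)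
  rw [evA, this]
  have e : ∀ k : ℕ, ((k + 1 : ℕ) : ℝ) * h - k * h = h := by intro k; push_cast; ring
  simp only [e, Finset.prod_const, Finset.card_range]

lemma aux_PAX (hB : IsStdBM P B) (h r a : ℝ) (hh : 0 < h) (k m : ℕ) (s : ℝ)
    (hs1 : k * h ≤ s) (hs2 : s ≤ (k + 1) * h) :
    P (evA B h r (k + 1 + m) ∩ {ω | B s ω - B (k * h) ω ∈ boxC a}) ≤
      gaussianPi (Fin 3) (s - k * h).toNNReal (boxC a) *
        gaussianPi (Fin 3) h.toNNReal (boxS r) ^ (k + m) := by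
  classical
  set q : ℕ → ℝ := fun i => if i ≤ k then i * h else if i = k + 1 then s else (i - 1 : ℝ) * h
    with hqd
  set F : ℕ → Set (Fin 3 → ℝ) := fun i => if i = k then boxC a else if i = k + 1 then univ
    else boxS r with hFd
  have q1 : ∀ i ≤ k, q i = i * h := by intro i hi; simp [hqd, hi]
  have q2 : q (k + 1) = s := by simp [hqd]
  have q3 : ∀ i, q (k + 2 + i) = (k + 1 + i : ℝ) * h := by
    intro i
    have a1 : ¬ (k + 2 + i ≤ k) := by omega
    have a2 : ¬ (k + 2 + i = k + 1) := by omega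
    simp only [hqd, a1, a2, if_false]; push_cast; ring
  have hmono : Monotone q := by
    apply monotone_nat_of_le_succ
    intro n
    rcases lt_trichotomy n k with hn | hn | hn
    · rw [q1 n hn.le, q1 (n + 1) hn]; push_cast; nlinarith
    · subst hn; rw [q1 n le_rfl, q2]; exact hs1
    · obtain ⟨j, rfl⟩ := Nat.exists_eq_add_of_lt hn
      rcases j with _ | j
      · rw [add_zero, q2, show k + 1 + 1 = k + 2 + 0 by ring, q3]; push_cast; linarith
      · rw [show k + (j + 1) + 1 = k + 2 + j by ring, q3, show k + 2 + j + 1 = k + 2 + (j + 1) by ring,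
          q3]; push_cast; nlinarith
  have hnn : ∀ i, 0 ≤ q i := by
    intro i
    have := hmono (Nat.zero_le i)
    rw [q1 0 (Nat.zero_le _)] at this
    simpa using this
  have hF : ∀ i, MeasurableSet (F i) := by
    intro i
    simp only [hFd]
    split_ifs
    exacts [meas_boxC a, MeasurableSet.univ, meas_boxS r]
  have key := aux_indep hB q hnn hmono (k + (m + 2)) F hF
  have hsub : evA B h r (k + 1 + m) ∩ {ω | B s ω - B (k * h) ω ∈ boxC a} ⊆
      {ω | ∀ i < k + (m + 2), B (q (i + 1)) ω - B (q i) ω ∈ F i} := by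
    rintro ω ⟨hA, hX⟩ i hi
    rcases lt_trichotomy i k with hn | hn | hn
    · rw [q1 i hn.le, q1 (i + 1) hn]
      have : F i = boxS r := by
        have : ¬ i = k + 1 := by omega
        simp [hFd, hn.ne, this]
      rw [this]
      exact hA i (by omega)
    · subst hn; rw [q1 i le_rfl, q2]
      have : F i = boxC a := by simp [hFd]
      rw [this]; exact hX
    · obtain ⟨j, rfl⟩ := Nat.exists_eq_add_of_lt hn
      rcases j with _ | j
      · have : F (k + 0 + 1) = univ := by simp [hFd]
        rw [this]; trivial
      · have : F (k + (j + 1) + 1) = boxS r := by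
          have a1 : ¬ (k + (j + 1) + 1 = k) := by omega
          have a2 : ¬ (k + (j + 1) + 1 = k + 1) := by omega
          simp only [hFd, a1, a2, if_false]
        rw [this, show k + (j + 1) + 1 = k + 2 + j by ring, q3,
          show k + 2 + j + 1 = k + 2 + (j + 1) by ring, q3]
        have := hA (k + 1 + j) (by omega)
        push_cast at this ⊢
        convert this using 3
        ring_nf
  refine (measure_mono hsub).trans ?_
  rw [key, Finset.prod_range_add, Finset.prod_range_succ', Finset.prod_range_succ']
  have t1 : ∏ x ∈ Finset.range k, gaussianPi (Fin 3) (q (x + 1) - q x).toNNReal (F x) =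
      gaussianPi (Fin 3) h.toNNReal (boxS r) ^ k := by
    rw [Finset.prod_congr rfl (g := fun _ => gaussianPi (Fin 3) h.toNNReal (boxS r))]
    · simp
    · intro x hx
      have hx := Finset.mem_range.1 hx
      have : F x = boxS r := by
        have : ¬ x = k + 1 := by omega
        simp [hFd, hx.ne, this]
      rw [this, q1 x hx.le, q1 (x + 1) hx]
      congr 2; push_cast; ring_nf
  have t2 : ∏ j ∈ Finset.range m, gaussianPi (Fin 3)
      (q (k + (j + 1 + 1) + 1) - q (k + (j + 1 + 1))).toNNReal (F (k + (j + 1 + 1))) =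
      gaussianPi (Fin 3) h.toNNReal (boxS r) ^ m := by
    rw [Finset.prod_congr rfl (g := fun _ => gaussianPi (Fin 3) h.toNNReal (boxS r))]
    · simp
    · intro j hx
      have : F (k + (j + 1 + 1)) = boxS r := by
        have a1 : ¬ (k + (j + 1 + 1) = k) := by omega
        have a2 : ¬ (k + (j + 1 + 1) = k + 1) := by omega
        simp only [hFd, a1, a2, if_false]
      rw [this, show k + (j + 1 + 1) = k + 2 + j by ring, q3,
          show k + 2 + j + 1 = k + 2 + (j + 1) by ring, q3]
      congr 2; push_cast; ring_nf
  have f1 : F (k + (0 + 1)) = univ := by simp [hFd]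
  have f2 : F (k + 0) = boxC a := by simp [hFd]
  rw [t1, t2, f1, f2]
  have hpr : ∀ v, gaussianPi (Fin 3) v univ = 1 := by
    intro v
    rw [gaussianPi]; exact measure_univ
  rw [hpr, mul_one, add_zero, q2, q1 k le_rfl, pow_add]
  apply le_of_eq; ring
end BM
section BM2
variable {Ω : Type*} [MeasurableSpace Ω] {P : Measure Ω} {B : ℝ → Ω → Fin 3 → ℝ}

lemma aux_grid (hB : IsStdBM P B) (h r : ℝ) (N : ℕ) (ω : Ω)
    (hω : ω ∈ evA B h r N) (i : Fin 3) (k : ℕ) (hk : k ≤ N) : |B (k * h) ω i| ≤ k * r := by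
  induction k with
  | zero => simp [hB.init]
  | succ k ih =>
    have h1 := ih (by omega)
    have h2 := hω k (by omega) i
    rw [Pi.sub_apply] at h2
    have h3 := abs_add_le (B ((k + 1 : ℕ) * h) ω i - B (k * h) ω i) (B (k * h) ω i)
    rw [sub_add_cancel] at h3
    push_cast at *
    linarith

lemma aux_bad (hB : IsStdBM P B) (h r a : ℝ) (hh : 0 < h) (hr : 0 ≤ r) (ha : 0 < a) (N : ℕ)
    (hNr : N * r ≤ a) (s : ℝ) (hs1 : 0 < s) (hs2 : s ≤ N * h) :
    P (evA B h r N ∩ {ω | B s ω ∈ boxC (2 * a)}) ≤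
      ENNReal.ofReal (6 * Real.exp (-(a ^ 2 / (2 * h)))) *
        gaussianPi (Fin 3) h.toNNReal (boxS r) ^ (N - 1) := by
  obtain ⟨k, hk⟩ : ∃ k, ⌈s / h⌉₊ = k + 1 :=
    Nat.exists_eq_succ_of_ne_zero (Nat.ceil_pos.2 (by positivity)).ne'
  have hk1 : k * h ≤ s := by
    have : (k : ℝ) < s / h := by
      apply Nat.lt_ceil.1; omega
    rw [lt_div_iff₀ hh] at this; exact this.le
  have hk2 : s ≤ (k + 1) * h := by
    have := Nat.le_ceil (s / h)
    rw [hk, div_le_iff₀ hh] at this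
    exact_mod_cast this
  have hk3 : k + 1 ≤ N := by
    rw [← hk]; apply Nat.ceil_le.2; rwa [div_le_iff₀ hh]
  obtain ⟨m, rfl⟩ := Nat.exists_eq_add_of_le hk3
  have hsub : evA B h r (k + 1 + m) ∩ {ω | B s ω ∈ boxC (2 * a)} ⊆
      evA B h r (k + 1 + m) ∩ {ω | B s ω - B (k * h) ω ∈ boxC a} := by
    rintro ω ⟨hA, i, hi⟩
    refine ⟨hA, i, ?_⟩
    have h1 := aux_grid hB h r _ ω hA i k (by omega)
    have h2 : (k : ℝ) * r ≤ a := by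
      refine le_trans ?_ hNr
      gcongr
      omega
    have h3 := abs_add_le (B s ω i - B (k * h) ω i) (B (k * h) ω i)
    rw [sub_add_cancel] at h3
    rw [Pi.sub_apply]
    linarith
  refine (measure_mono hsub).trans ((aux_PAX hB h r a hh k m s hk1 hk2).trans ?_)
  rw [show k + 1 + m - 1 = k + m by omega]
  gcongr
  exact aux_box_tail _ h a (by linarith) hh ha

lemma aux_markov [IsFiniteMeasure P] (A : Set Ω) (hA : MeasurableSet A) (S : Set (ℝ × Ω))
    (hS : MeasurableSet S) (t : ℝ) (ht : 0 < t)
    (hb : ∀ s ∈ Ioc 0 t, P (A ∩ {ω | (s, ω) ∈ S}) ≤ P A / 16) :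
    P A / 2 ≤ P (A ∩ {ω | volume ({s | (s, ω) ∈ S} ∩ Ioc 0 t) < ENNReal.ofReal (t / 8)}) := by
  set ν := volume.restrict (Ioc (0:ℝ) t) with hν
  set f : Ω → ENNReal := fun ω => ν ((fun s => (s, ω)) ⁻¹' S) with hf
  have hfm : Measurable f := measurable_measure_prodMk_right hS
  have hfe : ∀ ω, f ω = volume ({s | (s, ω) ∈ S} ∩ Ioc 0 t) := by
    intro ω
    rw [hf]
    simp only [hν]
    rw [Measure.restrict_apply (measurable_prodMk_right hS)]
    rfl
  simp_rw [← hfe]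
  have hint : ∫⁻ ω, f ω ∂(P.restrict A) ≤ ENNReal.ofReal t * (P A / 16) := by
    rw [← Measure.prod_apply_symm hS, Measure.prod_apply hS]
    calc ∫⁻ s, (P.restrict A) (Prod.mk s ⁻¹' S) ∂ν ≤ ∫⁻ s in Ioc 0 t, P A / 16 := by
          apply setLIntegral_mono' measurableSet_Ioc
          intro s hs
          rw [Measure.restrict_apply (measurable_prodMk_left hS), inter_comm]
          exact hb s hs
      _ = _ := by
          rw [setLIntegral_const, Real.volume_Ioc, sub_zero, mul_comm]
  have hmk := (mul_meas_ge_le_lintegral (μ := P.restrict A) hfm (ENNReal.ofReal (t / 8))).trans hint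
  have hm1 : MeasurableSet {ω | ENNReal.ofReal (t / 8) ≤ f ω} := measurableSet_le (by fun_prop) hfm
  rw [Measure.restrict_apply hm1] at hmk
  have hsplit : P A ≤ P ({ω | ENNReal.ofReal (t / 8) ≤ f ω} ∩ A) +
      P (A ∩ {ω | f ω < ENNReal.ofReal (t / 8)}) := by
    refine le_trans (measure_mono ?_) (measure_union_le _ _)
    intro ω hω
    rcases le_or_gt (ENNReal.ofReal (t / 8)) (f ω) with h | h
    · exact Or.inl ⟨h, hω⟩
    · exact Or.inr ⟨hω, h⟩
  set b := P ({ω | ENNReal.ofReal (t / 8) ≤ f ω} ∩ A)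
  set c := P (A ∩ {ω | f ω < ENNReal.ofReal (t / 8)})
  have hb' : b ≠ ⊤ := measure_ne_top _ _
  have hc' : c ≠ ⊤ := measure_ne_top _ _
  have ha' : P A ≠ ⊤ := measure_ne_top _ _
  have e1 : t / 8 * b.toReal ≤ t * ((P A).toReal / 16) := by
    have := ENNReal.toReal_mono (by finiteness) hmk
    simpa [ENNReal.toReal_mul, ENNReal.toReal_div, ENNReal.toReal_ofReal, ht.le,
      ENNReal.toReal_ofReal (show 0 ≤ t / 8 by positivity)] using this
  have e2 : (P A).toReal ≤ b.toReal + c.toReal := by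
    rw [← ENNReal.toReal_add hb' hc']
    exact ENNReal.toReal_mono (by finiteness) hsplit
  rw [← ENNReal.toReal_le_toReal (by finiteness) hc', ENNReal.toReal_div]
  simp only [ENNReal.toReal_ofNat]
  nlinarith

lemma aux_int (f : ℝ → ℝ) (hf : Continuous f) (a b c : ℝ) (hab : a ≤ b) (hc : 0 ≤ c)
    (hf0 : ∀ x ∈ Ioc a b, 0 ≤ f x) (S : Set ℝ) (hS : MeasurableSet S)
    (hSf : ∀ x ∈ Ioc a b, x ∉ S → c ≤ f x) (l : ℝ) (hl : volume (S ∩ Ioc a b) ≤ ENNReal.ofReal l)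
    (hl0 : 0 ≤ l) : c * (b - a - l) ≤ ∫ x in a..b, f x := by
  rw [intervalIntegral.integral_of_le hab]
  have hfi : IntegrableOn f (Ioc a b) := hf.integrableOn_Ioc
  have h1 : ∫ x in Ioc a b \ S, f x ≤ ∫ x in Ioc a b, f x := by
    apply setIntegral_mono_set hfi
    · exact (ae_restrict_iff' measurableSet_Ioc).2 (ae_of_all _ hf0)
    · exact (diff_subset).eventuallyLE
  have h2 : ∫ x in Ioc a b \ S, c ≤ ∫ x in Ioc a b \ S, f x := by
    apply setIntegral_mono_on
    · exact (integrableOn_const (by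
        exact ((measure_mono diff_subset).trans_lt (by simp)).ne))
    · exact hfi.mono_set diff_subset
    · exact measurableSet_Ioc.diff hS
    · intro x hx; exact hSf x hx.1 hx.2
  refine le_trans ?_ (h2.trans h1)
  rw [setIntegral_const, smul_eq_mul, mul_comm]
  gcongr
  have h3 : volume.real (S ∩ Ioc a b) ≤ l := ENNReal.toReal_le_of_le_ofReal hl0 hl
  have h4 : volume.real (Ioc a b) = b - a := by simp [hab]
  have h5 : volume.real (Ioc a b) ≤ volume.real (S ∩ Ioc a b) + volume.real (Ioc a b \ S) := by
    refine (measureReal_mono ?_ ?_).trans (measureReal_union_le _ _)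
    · intro x hx
      by_cases h : x ∈ S
      · exact Or.inl ⟨h, hx⟩
      · exact Or.inr ⟨hx, h⟩
    · refine (measure_union_lt_top ?_ ?_).ne
      · exact (measure_mono inter_subset_right).trans_lt (by simp)
      · exact (measure_mono diff_subset).trans_lt (by simp)
  linarith

lemma aux_path (R : (Fin 3 → ℝ) → ℝ) (hRcont : Continuous R) (hRnonneg : ∀ x, 0 ≤ R x)
    (δ : ℝ) (hδ : 0 < δ) (hRδ : ∀ x : Fin 3 → ℝ, Real.sqrt (∑ i, x i ^ 2) ≤ 2 → δ ≤ R x)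
    (ε : ℝ) (hε : 0 < ε) (t : ℝ) (ht : 0 < t) (b : ℝ → Fin 3 → ℝ) (hb : Continuous b)
    (hvol : volume ({s | b s ∈ boxC (ε / 2)} ∩ Ioc 0 t) < ENNReal.ofReal (t / 8)) :
    (ε ^ 3)⁻¹ * δ * (3 * t / 8) ^ 2 ≤
      ∫ s in (0:ℝ)..t, ∫ u in (0:ℝ)..s, (ε ^ 3)⁻¹ * R (ε⁻¹ • (b s - b u)) := by
  set S : Set ℝ := {s | b s ∈ boxC (ε / 2)} with hSd
  have hS : MeasurableSet S := hb.measurable (meas_boxC _)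
  have hgood : ∀ s u, s ∉ S → u ∉ S → (ε ^ 3)⁻¹ * δ ≤ (ε ^ 3)⁻¹ * R (ε⁻¹ • (b s - b u)) := by
    intro s u hs hu
    gcongr
    apply hRδ
    rw [Real.sqrt_le_left (by norm_num)]
    have hs' : ∀ i, |b s i| ≤ ε / 2 := by
      intro i; by_contra h; exact hs ⟨i, not_le.1 h⟩
    have hu' : ∀ i, |b u i| ≤ ε / 2 := by
      intro i; by_contra h; exact hu ⟨i, not_le.1 h⟩
    have : ∀ i, ((ε⁻¹ • (b s - b u)) i) ^ 2 ≤ 1 := by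
      intro i
      rw [sq_le_one_iff_abs_le_one, Pi.smul_apply, Pi.sub_apply, smul_eq_mul, abs_mul,
        abs_of_pos (inv_pos.2 hε), inv_mul_le_iff₀ hε]
      have := abs_sub (b s i) (b u i)
      linarith [hs' i, hu' i]
    calc _ ≤ ∑ i : Fin 3, (1:ℝ) := Finset.sum_le_sum fun i _ => this i
      _ ≤ _ := by norm_num
  have hgc : Continuous (Function.uncurry fun s u => (ε ^ 3)⁻¹ * R (ε⁻¹ • (b s - b u))) := by
    simp only [Function.uncurry_def]
    fun_prop
  have hG : Continuous fun s => ∫ u in (0:ℝ)..s, (ε ^ 3)⁻¹ * R (ε⁻¹ • (b s - b u)) :=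
    intervalIntegral.continuous_parametric_intervalIntegral_of_continuous hgc continuous_id
  have hG0 : ∀ s, 0 ≤ s → 0 ≤ ∫ u in (0:ℝ)..s, (ε ^ 3)⁻¹ * R (ε⁻¹ • (b s - b u)) := by
    intro s hs
    apply intervalIntegral.integral_nonneg hs
    intro u _
    have := hRnonneg (ε⁻¹ • (b s - b u))
    positivity
  have hG1 : ∀ s ∈ Ioc (t / 2) t, s ∉ S → (ε ^ 3)⁻¹ * δ * (3 * t / 8) ≤
      ∫ u in (0:ℝ)..s, (ε ^ 3)⁻¹ * R (ε⁻¹ • (b s - b u)) := by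
    intro s hs hsS
    refine le_trans ?_ (aux_int (fun u => (ε ^ 3)⁻¹ * R (ε⁻¹ • (b s - b u))) (by fun_prop) 0 s
      ((ε ^ 3)⁻¹ * δ) (by linarith [hs.1]) (by positivity) ?_ S hS
      (fun u _ hu => hgood s u hsS hu) (t / 8) ?_ (by positivity))
    · gcongr
      linarith [hs.1]
    · intro u _
      have := hRnonneg (ε⁻¹ • (b s - b u))
      positivity
    · refine le_trans (measure_mono ?_) hvol.le
      exact inter_subset_inter_right _ (Ioc_subset_Ioc_right hs.2)
  have h1 := aux_int (fun s => ∫ u in (0:ℝ)..s, (ε ^ 3)⁻¹ * R (ε⁻¹ • (b s - b u))) hG (t / 2) t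
      ((ε ^ 3)⁻¹ * δ * (3 * t / 8)) (by linarith) (by positivity)
      (fun s hs => hG0 s (by linarith [hs.1])) S hS hG1 (t / 8)
      (by
        refine le_trans (measure_mono ?_) hvol.le
        exact inter_subset_inter_right _ (Ioc_subset_Ioc_left (by linarith))) (by positivity)
  have h2 : 0 ≤ ∫ s in (0:ℝ)..(t / 2), ∫ u in (0:ℝ)..s, (ε ^ 3)⁻¹ * R (ε⁻¹ • (b s - b u)) :=
    intervalIntegral.integral_nonneg (by linarith) (fun s hs => hG0 s hs.1)
  rw [← intervalIntegral.integral_add_adjacent_intervals (b := t / 2)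
    (hG.intervalIntegrable _ _) (hG.intervalIntegrable _ _)]
  have e : (ε ^ 3)⁻¹ * δ * (3 * t / 8) * (t - t / 2 - t / 8) =
    (ε ^ 3)⁻¹ * δ * (3 * t / 8) ^ 2 := by ring
  linarith

lemma aux_fixed (hB : IsStdBM P B)
    (R : (Fin 3 → ℝ) → ℝ) (hRcont : Continuous R) (hRnonneg : ∀ x, 0 ≤ R x)
    (δ : ℝ) (hδ : 0 < δ) (hRδ : ∀ x : Fin 3 → ℝ, Real.sqrt (∑ i, x i ^ 2) ≤ 2 → δ ≤ R x)
    (ε : ℝ) (hε : 0 < ε) (t : ℝ) (ht : 0 < t) (N : ℕ) (hN : 0 < N) (ρ : ℝ) (hρ : 0 < ρ)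
    (hρ1 : ENNReal.ofReal ρ ≤ gaussianPi (Fin 3) (t / N).toNNReal (boxS (ε / (4 * N))))
    (hρ2 : 6 * Real.exp (-((ε / 4) ^ 2 / (2 * (t / N)))) ≤ ρ / 16) :
    ENNReal.ofReal (Real.exp ((ε ^ 3)⁻¹ * δ * (3 * t / 8) ^ 2) * (ρ ^ N / 2)) ≤
      ∫⁻ ω, ENNReal.ofReal (Real.exp (∫ s in (0:ℝ)..t, ∫ u in (0:ℝ)..s,
            (ε ^ 3)⁻¹ * R (ε⁻¹ • (B s ω - B u ω)))) ∂P := by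
  haveI := hB.isProb
  have hN' : (0:ℝ) < N := by exact_mod_cast hN
  set h := t / N with hh
  set r := ε / (4 * N) with hr
  have hh0 : 0 < h := by positivity
  have hr0 : 0 < r := by positivity
  set p := gaussianPi (Fin 3) h.toNNReal (boxS r) with hp
  have hA : MeasurableSet (evA B h r N) := by
    have : evA B h r N = ⋂ k, ⋂ (_ : k < N), (fun ω => B ((k + 1 : ℕ) * h) ω - B (k * h) ω) ⁻¹'
        boxS r := by
      ext ω; simp [evA]
    rw [this]
    exact MeasurableSet.iInter fun k => MeasurableSet.iInter fun _ =>
      ((hB.meas _).sub (hB.meas _)) (meas_boxS r)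
  have hcont : ∀ ω, Continuous fun s => B s ω := fun ω => continuous_pi (hB.cont ω)
  have hjm : Measurable (Function.uncurry B) :=
    measurable_uncurry_of_continuous_of_measurable hcont hB.meas
  set S : Set (ℝ × Ω) := Function.uncurry B ⁻¹' boxC (ε / 2)
  have hS : MeasurableSet S := hjm (meas_boxC _)
  have hPA := aux_PA hB h r hh0.le N
  have hm := aux_markov (P := P) (evA B h r N) hA S hS t ht (by
    intro s hs
    have h1 := aux_bad hB h r (ε / 4) hh0 hr0.le (by positivity) N
      (by rw [hr]; apply le_of_eq; field_simp) s hs.1 (by rw [hh]; field_simp; exact hs.2)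
    rw [show 2 * (ε / 4) = ε / 2 by ring] at h1
    refine h1.trans ?_
    rw [hPA, ← hp]
    calc _ ≤ (p / 16) * p ^ (N - 1) := by
          gcongr
          refine (ENNReal.ofReal_le_ofReal hρ2).trans ?_
          rw [ENNReal.ofReal_div_of_pos (by norm_num)]
          simp only [ENNReal.ofReal_ofNat]
          gcongr
      _ = p ^ (N - 1 + 1) / 16 := by
          rw [pow_succ, div_eq_mul_inv, div_eq_mul_inv]; ring
      _ = _ := by rw [Nat.sub_add_cancel hN])
  set G := evA B h r N ∩ {ω | volume ({s | (s, ω) ∈ S} ∩ Ioc 0 t) < ENNReal.ofReal (t / 8)}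
  have hG : MeasurableSet G := by
    apply hA.inter
    have hfm : Measurable (fun ω => (volume.restrict (Ioc (0:ℝ) t)) ((fun s => (s, ω)) ⁻¹' S)) :=
      measurable_measure_prodMk_right hS
    have := measurableSet_lt hfm (measurable_const (a := ENNReal.ofReal (t / 8)))
    convert this using 3 with ω
    rw [Measure.restrict_apply (measurable_prodMk_right hS)]
    rfl
  calc _ = ENNReal.ofReal (Real.exp ((ε ^ 3)⁻¹ * δ * (3 * t / 8) ^ 2)) *
        (ENNReal.ofReal ρ ^ N / 2) := by
        rw [ENNReal.ofReal_mul (by positivity), ENNReal.ofReal_div_of_pos (by norm_num),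
          ENNReal.ofReal_pow hρ.le]
        simp
    _ ≤ ENNReal.ofReal (Real.exp ((ε ^ 3)⁻¹ * δ * (3 * t / 8) ^ 2)) * P G := by
        gcongr
        refine le_trans ?_ hm
        rw [hPA]
        gcongr
    _ = ∫⁻ ω in G, ENNReal.ofReal (Real.exp ((ε ^ 3)⁻¹ * δ * (3 * t / 8) ^ 2)) ∂P := by
        rw [setLIntegral_const]
    _ ≤ ∫⁻ ω in G, ENNReal.ofReal (Real.exp (∫ s in (0:ℝ)..t, ∫ u in (0:ℝ)..s,
            (ε ^ 3)⁻¹ * R (ε⁻¹ • (B s ω - B u ω)))) ∂P := by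
        apply setLIntegral_mono' hG
        intro ω hω
        gcongr
        exact aux_path R hRcont hRnonneg δ hδ hRδ ε hε t ht (fun s => B s ω) (hcont ω) hω.2
    _ ≤ _ := setLIntegral_le_lintegral _ _
end BM2
lemma aux_asymp (t : ℝ) (ht : 0 < t) (δ' : ℝ) (hδ : 0 < δ') (c₁ c₂ c₃ : ℝ) :
    ∀ᶠ x : ℝ in atTop, 1 ≤ x ∧ 1 ≤ 32 * t * x ∧ 4 * Real.exp 1 * √(2 * π * t) ≤ x ∧
      96 * (x ^ 24 * Real.exp (-(x / (32 * t)))) ≤ 1 ∧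
      x ≤ -(c₁ * x ^ 2 + c₂ * Real.log (x ^ 2) + c₃) * t + δ' * x ^ 6 -
        48 * x ^ 5 * Real.log x := by
  have h1 : Tendsto (fun x : ℝ => 96 * (x ^ 24 * Real.exp (-(x / (32 * t))))) atTop (nhds 0) := by
    have := (tendsto_rpow_mul_exp_neg_mul_atTop_nhds_zero 24 (32 * t)⁻¹ (by positivity)).const_mul 96
    rw [mul_zero] at this
    refine this.congr' ?_
    filter_upwards [eventually_ge_atTop 0] with x hx
    rw [show (24:ℝ) = ((24:ℕ):ℝ) by norm_num, Real.rpow_natCast]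
    congr 3
    rw [div_eq_inv_mul]; ring
  have h2 : ∀ᶠ x : ℝ in atTop, ‖Real.log x‖ ≤ (min 1 (δ' / 96)) * ‖x‖ :=
    Real.isLittleO_log_id_atTop.bound (by positivity)
  set K := |c₁| * t + 2 * |c₂| * t + |c₃| * t + 1
  filter_upwards [eventually_ge_atTop 1, eventually_ge_atTop (1 / (32 * t)),
    eventually_ge_atTop (4 * Real.exp 1 * √(2 * π * t)), h1.eventually (ge_mem_nhds zero_lt_one), h2,
    eventually_ge_atTop (2 * K / δ')] with x hx1 hx2 hx3 hx4 hx5 hx6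
  have hl0 : 0 ≤ Real.log x := Real.log_nonneg hx1
  rw [Real.norm_of_nonneg hl0, Real.norm_of_nonneg (by linarith)] at hx5
  have hl1 : Real.log x ≤ x :=
    hx5.trans ((mul_le_mul_of_nonneg_right (min_le_left _ _) (by linarith)).trans (by linarith))
  have hl2 : Real.log x ≤ δ' / 96 * x :=
    hx5.trans (mul_le_mul_of_nonneg_right (min_le_right _ _) (by linarith))
  refine ⟨hx1, ?_, hx3, hx4, ?_⟩
  · rw [div_le_iff₀ (by positivity)] at hx2; linarith
  have a1 : 48 * x ^ 5 * Real.log x ≤ δ' / 2 * x ^ 6 := by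
    calc _ ≤ 48 * x ^ 5 * (δ' / 96 * x) := by gcongr
      _ = _ := by ring
  have hxx : x ≤ x ^ 2 := by nlinarith
  have b1 : c₁ * x ^ 2 * t ≤ |c₁| * t * x ^ 2 := by
    nlinarith [le_abs_self c₁, mul_nonneg ht.le (sq_nonneg x)]
  have b2 : c₂ * Real.log (x ^ 2) * t ≤ 2 * |c₂| * t * x ^ 2 := by
    rw [Real.log_pow]
    push_cast
    calc c₂ * (2 * Real.log x) * t ≤ |c₂| * (2 * x ^ 2) * t := by
          gcongr
          · exact le_abs_self _
          · linarith
      _ = _ := by ring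
  have b3 : c₃ * t ≤ |c₃| * t * x ^ 2 := by
    calc c₃ * t ≤ |c₃| * t * 1 := by rw [mul_one]; gcongr; exact le_abs_self _
      _ ≤ _ := by gcongr; nlinarith
  have b4 : K * x ^ 2 ≤ δ' / 2 * x ^ 6 := by
    rw [div_le_iff₀ hδ] at hx6
    have : x ≤ x ^ 4 := le_self_pow₀ hx1 (by norm_num)
    have : K ≤ δ' / 2 * x ^ 4 := by nlinarith
    calc K * x ^ 2 ≤ δ' / 2 * x ^ 4 * x ^ 2 := by gcongr
      _ = _ := by ring
  have b5 : K * x ^ 2 = |c₁| * t * x ^ 2 + 2 * |c₂| * t * x ^ 2 + |c₃| * t * x ^ 2 + x ^ 2 := by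
    simp only [K]; ring
  nlinarith

/-- For a standard 3D Brownian motion `B`, a continuous nonnegative `R` with
`R(x) ≥ δ > 0` for `|x| ≤ 2`, `R_ε(x) = ε⁻³ R(x/ε)`, and any renormalization
constant `C_ε = c₁ ε⁻¹ + c₂ log ε⁻¹ + c₃`, for every `t > 0`:
`e^{-C_ε t} E[exp(∫_0^t∫_0^s R_ε(B_s - B_u) du ds)] → ∞` as `ε → 0⁺`. -/
theorem stmt_17 (Ω : Type*) [MeasurableSpace Ω] (P : Measure Ω)
    (B : ℝ → Ω → Fin 3 → ℝ) (hB : IsStdBM P B)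
    (R : (Fin 3 → ℝ) → ℝ) (hRcont : Continuous R) (hRnonneg : ∀ x, 0 ≤ R x)
    (δ : ℝ) (hδ : 0 < δ) (hRδ : ∀ x : Fin 3 → ℝ, Real.sqrt (∑ i, x i ^ 2) ≤ 2 → δ ≤ R x)
    (c₁ c₂ c₃ : ℝ) (t : ℝ) (ht : 0 < t) :
    Tendsto (fun ε : ℝ =>
        ENNReal.ofReal (Real.exp (-(c₁ * ε⁻¹ + c₂ * Real.log ε⁻¹ + c₃) * t)) *
          ∫⁻ ω, ENNReal.ofReal (Real.exp (∫ s in (0:ℝ)..t, ∫ u in (0:ℝ)..s,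
            (ε ^ 3)⁻¹ * R (ε⁻¹ • (B s ω - B u ω)))) ∂P)
      (nhdsWithin 0 (Set.Ioi 0)) (nhds ⊤) := by
  have hx : Tendsto (fun ε : ℝ => √(ε⁻¹)) (nhdsWithin 0 (Set.Ioi 0)) atTop :=
    Real.tendsto_sqrt_atTop.comp tendsto_inv_nhdsGT_zero
  have hlim : Tendsto (fun ε : ℝ => ENNReal.ofReal (Real.exp (√(ε⁻¹)) / 2))
      (nhdsWithin 0 (Set.Ioi 0)) (nhds ⊤) :=
    ENNReal.tendsto_ofReal_atTop.comp
      ((Real.tendsto_exp_atTop.comp hx).atTop_div_const (by norm_num))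
  refine tendsto_nhds_top_mono hlim ?_
  filter_upwards [hx.eventually (aux_asymp t ht (δ * (3 * t / 8) ^ 2) (by positivity) c₁ c₂ c₃),
    self_mem_nhdsWithin] with ε hasy hε
  have hε : 0 < ε := hε
  set x := √(ε⁻¹) with hxd
  obtain ⟨h1, h2, h3, h4, h5⟩ := hasy
  have hx0 : 0 < x := by linarith
  have hx2 : ε⁻¹ = x ^ 2 := by rw [hxd, Real.sq_sqrt (by positivity)]
  have hεx : ε = (x ^ 2)⁻¹ := by rw [← hx2, inv_inv]
  obtain ⟨N, hN1, hN2⟩ : ∃ N : ℕ, x ^ 5 ≤ N ∧ (N : ℝ) ≤ 2 * x ^ 5 := by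
    refine ⟨⌈x ^ 5⌉₊, Nat.le_ceil _, ?_⟩
    have a1 := Nat.ceil_lt_add_one (show 0 ≤ x ^ 5 by positivity)
    have a2 : 1 ≤ x ^ 5 := one_le_pow₀ h1
    linarith
  have hN1' : (1:ℝ) ≤ N := le_trans (one_le_pow₀ h1) hN1
  have hN0 : (0:ℝ) < N := by linarith
  have hfix := aux_fixed hB R hRcont hRnonneg δ hδ hRδ ε hε t ht N (by exact_mod_cast hN0)
    ((x ^ 8)⁻¹ ^ 3) (by positivity) ?_ ?_
  · calc ENNReal.ofReal (Real.exp x / 2)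
        ≤ ENNReal.ofReal (Real.exp (-(c₁ * ε⁻¹ + c₂ * Real.log ε⁻¹ + c₃) * t) *
          (Real.exp ((ε ^ 3)⁻¹ * δ * (3 * t / 8) ^ 2) * (((x ^ 8)⁻¹ ^ 3) ^ N / 2))) := by
          apply ENNReal.ofReal_le_ofReal
          have e1 : ((x ^ 8)⁻¹ ^ 3) ^ N = Real.exp (-(24 * Real.log x * N)) := by
            rw [Real.exp_neg, mul_comm _ (N:ℝ), Real.exp_nat_mul,
              show 24 * Real.log x = ((24:ℕ):ℝ) * Real.log x by norm_num, Real.exp_nat_mul,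
              Real.exp_log hx0, inv_pow, inv_pow]
            congr 2
            ring
          have e2 : (ε ^ 3)⁻¹ = x ^ 6 := by rw [← inv_pow, hx2]; ring
          rw [e1, e2, hx2, ← mul_div_assoc, ← mul_div_assoc, ← Real.exp_add, ← Real.exp_add]
          gcongr
          have : 24 * Real.log x * N ≤ 24 * Real.log x * (2 * x ^ 5) := by
            have := Real.log_nonneg h1
            gcongr
          nlinarith
      _ = _ := ENNReal.ofReal_mul (by positivity)
      _ ≤ _ := by gcongr
  · refine le_trans (ENNReal.ofReal_le_ofReal ?_)
      (aux_box_lower (t / N) (ε / (4 * N)) (by positivity) (by positivity) ?_)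
    · gcongr
      have hs : √(2 * π * (t / N)) ≤ √(2 * π * t) := by
        gcongr
        exact div_le_self ht.le hN1'
      have hs0 : 0 < √(2 * π * (t / N)) := Real.sqrt_pos.2 (by positivity)
      have hN3 : (4 * x ^ 7)⁻¹ ≤ 2 * (ε / (4 * N)) := by
        rw [hεx]
        calc (4 * x ^ 7)⁻¹ = 2 * ((x ^ 2)⁻¹ / (4 * (2 * x ^ 5))) := by field_simp
          _ ≤ _ := by gcongr
      calc (x ^ 8)⁻¹ = (4 * x ^ 7)⁻¹ * (4 * x⁻¹) := by field_simp
        _ ≤ (4 * x ^ 7)⁻¹ * ((√(2 * π * t))⁻¹ * Real.exp (-1)) := by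
            refine mul_le_mul_of_nonneg_left ?_ (by positivity)
            have : 0 < √(2 * π * t) := Real.sqrt_pos.2 (by positivity)
            rw [Real.exp_neg, ← mul_inv, ← div_eq_mul_inv, div_le_iff₀ hx0,
              inv_mul_eq_div, le_div_iff₀ (by positivity)]
            linarith
        _ ≤ _ := by gcongr
    · have hε1 : ε ≤ 1 := by
        rw [hεx]; exact inv_le_one_of_one_le₀ (one_le_pow₀ h1)
      rw [div_pow, div_le_iff₀ (by positivity)]
      have : ε ^ 2 ≤ 1 := pow_le_one₀ hε.le hε1
      have h6 : 32 * t * x ≤ 32 * t * N := by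
        gcongr
        exact le_trans (le_self_pow₀ h1 (by norm_num)) hN1
      calc ε ^ 2 ≤ 32 * t * N := by linarith
        _ = _ := by field_simp; norm_num
  · have h6 : Real.exp (-((ε / 4) ^ 2 / (2 * (t / N)))) ≤ Real.exp (-(x / (32 * t))) := by
      refine Real.exp_le_exp.2 (neg_le_neg ?_)
      calc x / (32 * t) = ((x ^ 2)⁻¹ / 4) ^ 2 / (2 * (t / x ^ 5)) := by field_simp; norm_num
        _ ≤ _ := by rw [hεx]; gcongr
    have h7 : (x ^ 8)⁻¹ ^ 3 = (x ^ 24)⁻¹ := by rw [inv_pow]; congr 1; ring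
    rw [h7]
    have h8 : 96 * Real.exp (-(x / (32 * t))) ≤ (x ^ 24)⁻¹ := by
      rw [← one_div, le_div_iff₀ (by positivity)]
      linarith
    linarith
end

section
/- Let $B$ be a standard planar Brownian motion started at the origin, let $R : \mathbb{R}^2 \to \mathbb{R}$ be a continuous nonnegative function with $R(x) \ge \delta > 0$ for all $|x| \le 2$, set $R_\varepsilon(x) = \varepsilon^{-2} R(x/\varepsilon)$, and let $C_\varepsilon = \frac{1}{\pi}\log \varepsilon^{-1}$. Let $c' > 0$ be a constant such that $\mathbb{P}[\sup_{s \in [0,t]} |B_s| < \varepsilon] \ge e^{-c' t/\varepsilon^2}$ for all $\varepsilon \in (0,1)$ and $t \ge \varepsilon^2$. Then for every $t > 2c'/\delta$, $\lim_{\varepsilon \to 0^+} e^{-C_\varepsilon t}\, \mathbb{E}_{\mathbf{B}}\Big[ \exp\Big( \int_0^t \int_0^s R_\varepsilon(B_s - B_u)\, du\, ds \Big) \Big] = \infty$. -/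
open MeasureTheory ProbabilityTheory Real Filter Set

theorem aux_lim (a K : ℝ) (ha : 0 ≤ a) (hK : 0 < K) :
    Tendsto (fun ε : ℝ => -(π⁻¹ * Real.log ε⁻¹) * a + K * (ε ^ 2)⁻¹)
      (nhdsWithin 0 (Set.Ioi 0)) atTop := by
  have h1 : Tendsto (fun x : ℝ => x * (K * x - π⁻¹ * a)) atTop atTop := by
    apply Tendsto.atTop_mul_atTop₀ tendsto_id
    exact tendsto_atTop_add_const_right _ _ (Tendsto.const_mul_atTop hK tendsto_id)
  have h2 := h1.comp (tendsto_inv_nhdsGT_zero (𝕜 := ℝ))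
  refine tendsto_atTop_mono' _ ?_ h2
  filter_upwards [self_mem_nhdsWithin] with ε hε
  have hε : 0 < ε := hε
  have hl : Real.log ε⁻¹ ≤ ε⁻¹ := by
    have := Real.log_le_sub_one_of_pos (inv_pos.mpr hε)
    linarith
  have hp : 0 ≤ π⁻¹ * a := mul_nonneg (inv_nonneg.mpr pi_pos.le) ha
  have := mul_le_mul_of_nonneg_left hl hp
  simp only [Function.comp]
  rw [← inv_pow]
  nlinarith

theorem aux_norm (x y : Fin 2 → ℝ) (ε : ℝ) (hε : 0 < ε)
    (hx : Real.sqrt (∑ i, x i ^ 2) ≤ ε) (hy : Real.sqrt (∑ i, y i ^ 2) ≤ ε) :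
    Real.sqrt (∑ i, (ε⁻¹ • (x - y)) i ^ 2) ≤ 2 := by
  rw [Real.sqrt_le_left hε.le] at hx hy
  rw [Real.sqrt_le_left (by norm_num)]
  simp only [Fin.sum_univ_two, Pi.smul_apply, Pi.sub_apply, smul_eq_mul, mul_pow] at *
  rw [← mul_add, inv_pow, inv_mul_le_iff₀ (by positivity)]
  nlinarith [sq_nonneg (x 0 + y 0), sq_nonneg (x 1 + y 1)]

theorem aux_int_s18 (b : ℝ → Fin 2 → ℝ) (hb : Continuous b)
    (R : (Fin 2 → ℝ) → ℝ) (hRcont : Continuous R) 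
    (δ : ℝ) (hRδ : ∀ x : Fin 2 → ℝ, Real.sqrt (∑ i, x i ^ 2) ≤ 2 → δ ≤ R x)
    (t : ℝ) (ht : 0 ≤ t) (ε : ℝ) (hε : 0 < ε)
    (h : ∀ s ∈ Set.Icc (0:ℝ) t, Real.sqrt (∑ i, b s i ^ 2) ≤ ε) :
    δ * t ^ 2 / 2 * (ε ^ 2)⁻¹ ≤ ∫ s in (0:ℝ)..t, ∫ u in (0:ℝ)..s,
            (ε ^ 2)⁻¹ * R (ε⁻¹ • (b s - b u)) := by
  have hc : Continuous (fun p : ℝ × ℝ => (ε ^ 2)⁻¹ * R (ε⁻¹ • (b p.1 - b p.2))) := by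
    fun_prop
  have h0 : ∫ s in (0:ℝ)..t, ∫ u in (0:ℝ)..s, (ε ^ 2)⁻¹ * δ = δ * t ^ 2 / 2 * (ε ^ 2)⁻¹ := by
    simp
    ring
  rw [← h0]
  apply intervalIntegral.integral_mono_on ht
  · apply Continuous.intervalIntegrable
    simp only [intervalIntegral.integral_const]
    fun_prop
  · apply Continuous.intervalIntegrable
    exact intervalIntegral.continuous_parametric_intervalIntegral_of_continuous
      (f := fun s u => (ε ^ 2)⁻¹ * R (ε⁻¹ • (b s - b u))) hc continuous_id
  · intro s hs
    apply intervalIntegral.integral_mono_on hs.1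
    · exact continuous_const.intervalIntegrable _ _
    · apply Continuous.intervalIntegrable
      fun_prop
    · intro u hu
      apply mul_le_mul_of_nonneg_left _ (by positivity)
      exact hRδ _ (aux_norm _ _ ε hε (h s hs) (h u ⟨hu.1, hu.2.trans hs.2⟩))

theorem aux_meas {Ω : Type*} [MeasurableSpace Ω] (B : ℝ → Ω → Fin 2 → ℝ)
    (hc : ∀ ω, Continuous fun t => B t ω) (hm : ∀ t, Measurable (B t)) (t ε : ℝ) :
    MeasurableSet {ω | ∀ s ∈ Set.Icc (0:ℝ) t, Real.sqrt (∑ i, B s ω i ^ 2) ≤ ε} := by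
  obtain ⟨D, hDc, hDd⟩ := TopologicalSpace.exists_countable_dense (Set.Icc (0:ℝ) t)
  have : {ω | ∀ s ∈ Set.Icc (0:ℝ) t, Real.sqrt (∑ i, B s ω i ^ 2) ≤ ε} =
      ⋂ s ∈ D, {ω | Real.sqrt (∑ i, B (s : ℝ) ω i ^ 2) ≤ ε} := by
    ext ω
    simp only [Set.mem_setOf_eq, Set.mem_iInter]
    constructor
    · intro h s _
      exact h s s.2
    · intro h s hs
      have hcl : IsClosed {s : Set.Icc (0:ℝ) t | Real.sqrt (∑ i, B (s : ℝ) ω i ^ 2) ≤ ε} := by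
        apply isClosed_le _ continuous_const
        have := hc ω
        fun_prop
      have h2 := hDd.closure_eq ▸ closure_minimal (fun s hs => h s hs) hcl
      exact h2 (Set.mem_univ ⟨s, hs⟩)
  rw [this]
  apply MeasurableSet.biInter hDc
  intro s _
  apply measurableSet_le _ measurable_const
  have := hm s
  fun_prop

/-- For a standard planar Brownian motion `B`, a continuous nonnegative `R` with
`R(x) ≥ δ > 0` for `|x| ≤ 2`, `R_ε(x) = ε⁻² R(x/ε)`, `C_ε = π⁻¹ log ε⁻¹`, and a
constant `c' > 0` giving the small-ball bound `P[sup_{s∈[0,t]} |B_s| < ε] ≥ e^{-c't/ε²}`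
for `ε ∈ (0,1)`, `t ≥ ε²`: for every `t > 2c'/δ`,
`e^{-C_ε t} E[exp(∫_0^t∫_0^s R_ε(B_s - B_u) du ds)] → ∞` as `ε → 0⁺`. -/
theorem stmt_18 (Ω : Type*) [MeasurableSpace Ω] (P : Measure Ω)
    (B : ℝ → Ω → Fin 2 → ℝ) (hB : IsStdBM P B)
    (R : (Fin 2 → ℝ) → ℝ) (hRcont : Continuous R) (hRnonneg : ∀ x, 0 ≤ R x)
    (δ : ℝ) (hδ : 0 < δ) (hRδ : ∀ x : Fin 2 → ℝ, Real.sqrt (∑ i, x i ^ 2) ≤ 2 → δ ≤ R x)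
    (c' : ℝ) (hc' : 0 < c')
    (hsmallball : ∀ ε ∈ Set.Ioo (0:ℝ) 1, ∀ t : ℝ, ε ^ 2 ≤ t →
      ENNReal.ofReal (Real.exp (-c' * t / ε ^ 2)) ≤
        P {ω | ∀ s ∈ Set.Icc (0:ℝ) t, Real.sqrt (∑ i, B s ω i ^ 2) < ε})
    (t : ℝ) (ht : 2 * c' / δ < t) :
    Tendsto (fun ε : ℝ =>
        ENNReal.ofReal (Real.exp (-(π⁻¹ * Real.log ε⁻¹) * t)) *
          ∫⁻ ω, ENNReal.ofReal (Real.exp (∫ s in (0:ℝ)..t, ∫ u in (0:ℝ)..s,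
            (ε ^ 2)⁻¹ * R (ε⁻¹ • (B s ω - B u ω)))) ∂P)
      (nhdsWithin 0 (Set.Ioi 0)) (nhds ⊤) := by
  have ht0 : 0 < t := lt_trans (by positivity) ht
  have hcont : ∀ ω, Continuous fun t => B t ω := fun ω => continuous_pi (hB.cont ω)
  have hK : 0 < δ * t ^ 2 / 2 - c' * t := by
    rw [div_lt_iff₀ hδ] at ht
    nlinarith
  have hlim := ENNReal.tendsto_ofReal_atTop.comp
    (Real.tendsto_exp_atTop.comp (aux_lim t _ ht0.le hK))
  refine tendsto_of_tendsto_of_tendsto_of_le_of_le' hlim tendsto_const_nhds ?_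
    (Eventually.of_forall fun _ => le_top)
  have hev : ∀ᶠ ε : ℝ in nhdsWithin 0 (Set.Ioi 0), ε ^ 2 < t := by
    have : Tendsto (fun ε : ℝ => ε ^ 2) (nhdsWithin 0 (Set.Ioi 0)) (nhds 0) := by
      have h : Tendsto (fun ε : ℝ => ε ^ 2) (nhds 0) (nhds (0 ^ 2)) :=
        (continuous_pow 2).tendsto 0
      simp only [ne_eq, OfNat.ofNat_ne_zero, not_false_eq_true, zero_pow] at h
      exact h.mono_left nhdsWithin_le_nhds
    exact this.eventually_lt_const ht0
  filter_upwards [hev, Ioo_mem_nhdsGT (zero_lt_one (α := ℝ))] with ε hε2 hε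
  have hsb := hsmallball ε hε t hε2.le
  have hA := aux_meas B hcont hB.meas t ε
  set A := {ω | ∀ s ∈ Set.Icc (0:ℝ) t, Real.sqrt (∑ i, B s ω i ^ 2) ≤ ε} with hAdef
  have hPA : ENNReal.ofReal (Real.exp (-c' * t / ε ^ 2)) ≤ P A :=
    hsb.trans (measure_mono fun ω hω s hs => (hω s hs).le)
  have hexp : Real.exp (-(π⁻¹ * Real.log ε⁻¹) * t + (δ * t ^ 2 / 2 - c' * t) * (ε ^ 2)⁻¹) =
      Real.exp (-(π⁻¹ * Real.log ε⁻¹) * t) *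
        (Real.exp (δ * t ^ 2 / 2 * (ε ^ 2)⁻¹) * Real.exp (-c' * t / ε ^ 2)) := by
    rw [← Real.exp_add, ← Real.exp_add]
    congr 1
    ring
  simp only [Function.comp]
  rw [hexp, ENNReal.ofReal_mul (Real.exp_pos _).le, ENNReal.ofReal_mul (Real.exp_pos _).le]
  gcongr
  calc _ ≤ ENNReal.ofReal (Real.exp (δ * t ^ 2 / 2 * (ε ^ 2)⁻¹)) * P A := by gcongr
    _ = ∫⁻ ω in A, ENNReal.ofReal (Real.exp (δ * t ^ 2 / 2 * (ε ^ 2)⁻¹)) ∂P := by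
      rw [setLIntegral_const]
    _ ≤ ∫⁻ ω in A, ENNReal.ofReal (Real.exp (∫ s in (0:ℝ)..t, ∫ u in (0:ℝ)..s,
            (ε ^ 2)⁻¹ * R (ε⁻¹ • (B s ω - B u ω)))) ∂P := by
      apply setLIntegral_mono' hA
      intro ω hω
      apply ENNReal.ofReal_le_ofReal
      apply Real.exp_le_exp.mpr
      exact aux_int_s18 (fun s => B s ω) (hcont ω) R hRcont δ hRδ t ht0.le ε hε.1 hω
    _ ≤ _ := setLIntegral_le_lintegral _ _
end
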